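/- arXiv:1504.00695 — 2 statements merged into one kernel-verified Lean document; each statement's English description precedes it below -/
import Mathlib

section
/- Let Ξ be a finite alphabet with |Ξ| ≥ 2, q ≥ 3 an integer, 0 < ε ≤ 1, let n be an integer with n > (24q^{10}(log₂|Ξ|)²/ε)^q, and set α = 10³ ln(|Ξ|)·q⁴/ε. If the pair (L',L) over Ξ^n is ε-nontrivial and admits a combinatorial non-adaptive 2-sided partial (ε/2, 1/(4q³), q, q⁹ log₂(|Ξ|)(log₂(log₂(|Ξ|)/ε))²·n)-test, then (L',L) admits a p-sampling 2-sided (ε, 1/10)-test with p = α·n^{−1/q²}. -/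
open scoped Classical BigOperators

noncomputable section

/-- `w` and `v` differ in more than `ε·n` coordinates. -/
def FarWord {n : ℕ} {Ξ : Type*} (ε : ℝ) (w v : Fin n → Ξ) : Prop :=
  ε * n < ((Finset.univ.filter fun i => w i ≠ v i).card : ℝ)

/-- `w` is `ε`-far from every word of `L`. -/
def FarFrom {n : ℕ} {Ξ : Type*} (ε : ℝ) (w : Fin n → Ξ) (L : Set (Fin n → Ξ)) : Prop :=
  ∀ v ∈ L, FarWord ε w v

/-- `Q` is a witness against `w` with regard to `L`. -/
def IsWitness {n : ℕ} {Ξ : Type*} (L : Set (Fin n → Ξ)) (w : Fin n → Ξ)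
    (Q : Finset (Fin n)) : Prop :=
  ∀ u : Fin n → Ξ, (∀ i ∈ Q, u i = w i) → u ∉ L

/-- `μ` is a probability distribution over subsets of `[n]`. -/
def IsDistr {n : ℕ} (μ : Finset (Fin n) → ℝ) : Prop :=
  (∀ Q, 0 ≤ μ Q) ∧ ∑ Q : Finset (Fin n), μ Q = 1

/-- The support of a distribution over subsets of `[n]`. -/
def distSupp {n : ℕ} (μ : Finset (Fin n) → ℝ) : Finset (Finset (Fin n)) :=
  Finset.univ.filter fun Q => 0 < μ Q

/-- `μ(𝒜) = Σ_{Q ∈ 𝒜} μ(Q)`. -/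
def mass {n : ℕ} (μ : Finset (Fin n) → ℝ) (A : Finset (Finset (Fin n))) : ℝ :=
  ∑ Q ∈ A, μ Q

/-- Probability that a `p`-sampled subset of `[n]` (each index included independently
with probability `p`) satisfies the event `E`. -/
def sampleProb (n : ℕ) (p : ℝ) (E : Finset (Fin n) → Prop) : ℝ :=
  ∑ R ∈ Finset.univ.filter E, p ^ R.card * (1 - p) ^ (n - R.card)

/-- A non-adaptive 1-sided `(ε,δ)`-test for `L`: a distribution over subsets of `[n]`
that against every `ε`-far word yields a witness with probability at least `1-δ`. -/
def IsOneSidedTest {n : ℕ} {Ξ : Type*} (ε δ : ℝ) (μ : Finset (Fin n) → ℝ)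
    (L : Set (Fin n → Ξ)) : Prop :=
  IsDistr μ ∧
    ∀ w : Fin n → Ξ, FarFrom ε w L →
      1 - δ ≤ mass μ (Finset.univ.filter fun Q => IsWitness L w Q)


/-- A probabilistic formula over `Ξ^n`: a satisfaction function `S Q : Ξ^n → [0,1]`
for every query set `Q ⊆ [n]` (depending only on the restriction to `Q`, i.e., on
`w_Q ∈ Ξ^{|Q|}`), together with a probability distribution `μ` over the query sets. -/
structure ProbFormula (n : ℕ) (Ξ : Type*) where
  S : Finset (Fin n) → (Fin n → Ξ) → ℝ
  μ : Finset (Fin n) → ℝ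
  μ_nonneg : ∀ Q, 0 ≤ μ Q
  μ_sum : ∑ Q : Finset (Fin n), μ Q = 1
  S_range : ∀ Q w, 0 ≤ S Q w ∧ S Q w ≤ 1
  S_local : ∀ Q (w w' : Fin n → Ξ), (∀ i ∈ Q, w i = w' i) → S Q w = S Q w'

namespace ProbFormula

variable {n : ℕ} {Ξ : Type*}

/-- The satisfaction of `P` by `w`: the expectation of `S(w_Q)` for `(Q,S)` drawn
according to `μ`. -/
def sat (P : ProbFormula n Ξ) (w : Fin n → Ξ) : ℝ :=
  ∑ Q : Finset (Fin n), P.μ Q * P.S Q w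

/-- The support of the distribution of `P`. -/
def supp (P : ProbFormula n Ξ) : Finset (Finset (Fin n)) :=
  Finset.univ.filter fun Q => 0 < P.μ Q

/-- `P` is a `q`-formula: all query sets in the support have cardinality `q`. -/
def IsQForm (P : ProbFormula n Ξ) (q : ℕ) : Prop :=
  ∀ Q, 0 < P.μ Q → Q.card = q

/-- `P` is zero-one: all satisfaction functions of constraints in the support take
values in `{0,1}`. -/
def ZeroOne (P : ProbFormula n Ξ) : Prop :=
  ∀ Q, 0 < P.μ Q → ∀ w, P.S Q w = 0 ∨ P.S Q w = 1

/-- `P` is `β`-equitable: `μ(C₁) ≤ β·μ(C₂)` for all constraints in the support. -/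
def Equitable (P : ProbFormula n Ξ) (β : ℝ) : Prop :=
  ∀ Q Q', 0 < P.μ Q → 0 < P.μ Q' → P.μ Q ≤ β * P.μ Q'

/-- `P` is 1-equitable: `μ` is uniform over its support. -/
def Uniform (P : ProbFormula n Ξ) : Prop :=
  ∀ Q Q', 0 < P.μ Q → 0 < P.μ Q' → P.μ Q = P.μ Q'

/-- `P` is combinatorial: zero-one and 1-equitable. -/
def Combinatorial (P : ProbFormula n Ξ) : Prop :=
  P.ZeroOne ∧ P.Uniform

/-- `P` is a non-adaptive 2-sided partial `(ε,δ)`-test for `(L',L)`. -/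
def IsPartialTest (P : ProbFormula n Ξ) (ε δ : ℝ) (L' L : Set (Fin n → Ξ)) : Prop :=
  (∀ w ∈ L', 1 - δ ≤ P.sat w) ∧
  ∀ w : Fin n → Ξ, FarFrom ε w L → P.sat w ≤ δ

end ProbFormula

/-- The pair `(L',L)` is `ε`-nontrivial: `L'` is nonempty and some word of `Ξ^n` is
`ε`-far from `L`. -/
def NontrivialPair {n : ℕ} {Ξ : Type*} (ε : ℝ) (L' L : Set (Fin n → Ξ)) : Prop :=
  L'.Nonempty ∧ ∃ w : Fin n → Ξ, FarFrom ε w L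

/-- weight of a sampled set -/
def swt (n : ℕ) (p : ℝ) (U : Finset (Fin n)) : ℝ := p ^ U.card * (1 - p) ^ (n - U.card)

lemma swt_nonneg {n : ℕ} {p : ℝ} (h0 : 0 ≤ p) (h1 : p ≤ 1) (U : Finset (Fin n)) :
    0 ≤ swt n p U := by
  unfold swt
  have : 0 ≤ 1 - p := by linarith
  positivity

lemma swt_super {n : ℕ} (p : ℝ) (B : Finset (Fin n)) :
    ∑ U : Finset (Fin n), swt n p U * (if B ⊆ U then 1 else 0) = p ^ B.card := by
  have h := Finset.prod_add (fun _ : Fin n => p) (fun i => if i ∈ B then 0 else 1 - p)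
    (Finset.univ)
  have h2 : ∏ i : Fin n, (p + if i ∈ B then 0 else 1 - p) = p ^ B.card := by
    have : ∀ i : Fin n, (p + if i ∈ B then 0 else 1 - p) = if i ∈ B then p else 1 := by
      intro i; split_ifs <;> ring
    simp only [this]
    rw [Finset.prod_ite]
    simp
  rw [h2] at h
  rw [h, Finset.powerset_univ]
  refine Finset.sum_congr rfl fun U _ => ?_
  unfold swt
  by_cases hB : B ⊆ U
  · have : ∏ i ∈ Finset.univ \ U, (if i ∈ B then (0:ℝ) else 1 - p)
        = ∏ i ∈ Finset.univ \ U, (1 - p) := by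
      refine Finset.prod_congr rfl fun i hi => ?_
      have : i ∉ B := fun h => (Finset.mem_sdiff.1 hi).2 (hB h)
      simp [this]
    rw [this]
    simp [hB, Finset.card_sdiff, Finset.prod_const]
  · obtain ⟨i, hi, hiU⟩ := Finset.not_subset.1 hB
    have : ∏ i ∈ Finset.univ \ U, (if i ∈ B then (0:ℝ) else 1 - p) = 0 := by
      apply Finset.prod_eq_zero (i := i)
      · simp [hiU]
      · simp [hi]
    rw [this]; simp [hB]

lemma swt_prod {n : ℕ} {ι : Type*} (p c : ℝ) (j : ℕ) (B : ι → Finset (Fin n)) (H : Finset ι) :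
    ∀ A : Finset (Fin n), (∀ Q ∈ H, Disjoint A (B Q)) → (∀ Q ∈ H, (B Q).card = j) →
    (∀ Q ∈ H, ∀ Q' ∈ H, Q ≠ Q' → Disjoint (B Q) (B Q')) →
    ∑ U : Finset (Fin n), swt n p U * ((if A ⊆ U then 1 else 0) *
      ∏ Q ∈ H, (1 + c * (if B Q ⊆ U then 1 else 0))) = p ^ A.card * (1 + c * p ^ j) ^ H.card := by
  induction H using Finset.induction_on with
  | empty => intro A _ _ _; simpa using swt_super p A
  | insert Q H hQ ih =>
    intro A hA hj hd
    have e : ∀ U : Finset (Fin n), swt n p U * ((if A ⊆ U then 1 else 0) *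
      ∏ Q ∈ insert Q H, (1 + c * (if B Q ⊆ U then 1 else 0))) =
      swt n p U * ((if A ⊆ U then 1 else 0) * ∏ Q ∈ H, (1 + c * (if B Q ⊆ U then 1 else 0)))
      + c * (swt n p U * ((if A ∪ B Q ⊆ U then 1 else 0) *
        ∏ Q ∈ H, (1 + c * (if B Q ⊆ U then 1 else 0)))) := by
      intro U
      rw [Finset.prod_insert hQ]
      by_cases h1 : A ⊆ U <;> by_cases h2 : B Q ⊆ U <;>
        simp [h1, h2, Finset.union_subset_iff] <;> ring
    simp only [e]
    rw [Finset.sum_add_distrib, ← Finset.mul_sum]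
    rw [ih A (fun R hR => hA R (Finset.mem_insert_of_mem hR))
      (fun R hR => hj R (Finset.mem_insert_of_mem hR))
      (fun R hR R' hR' => hd R (Finset.mem_insert_of_mem hR) R' (Finset.mem_insert_of_mem hR'))]
    rw [ih (A ∪ B Q) (fun R hR => ?_)
      (fun R hR => hj R (Finset.mem_insert_of_mem hR))
      (fun R hR R' hR' => hd R (Finset.mem_insert_of_mem hR) R' (Finset.mem_insert_of_mem hR'))]
    · rw [Finset.card_union_of_disjoint (hA Q (Finset.mem_insert_self _ _)),
        hj Q (Finset.mem_insert_self _ _), Finset.card_insert_of_notMem hQ]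
      ring
    · rw [Finset.disjoint_union_left]
      refine ⟨hA R (Finset.mem_insert_of_mem hR), hd Q (Finset.mem_insert_self _ _) R
        (Finset.mem_insert_of_mem hR) ?_⟩
      rintro rfl; exact hQ hR

lemma swt_mgf_disj {n : ℕ} {ι : Type*} {p : ℝ} (h0 : 0 ≤ p) (h1 : p ≤ 1) (s : ℝ) (j : ℕ)
    (B : ι → Finset (Fin n)) (H : Finset ι) (hj : ∀ Q ∈ H, (B Q).card = j)
    (hd : ∀ Q ∈ H, ∀ Q' ∈ H, Q ≠ Q' → Disjoint (B Q) (B Q')) :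
    ∑ U : Finset (Fin n), swt n p U * Real.exp (s * ((H.filter fun Q => B Q ⊆ U).card : ℝ))
      ≤ Real.exp (p ^ j * H.card * (Real.exp s - 1)) := by
  have h := swt_prod p (Real.exp s - 1) j B H ∅ (by simp) hj hd
  have e : ∀ U : Finset (Fin n), Real.exp (s * ((H.filter fun Q => B Q ⊆ U).card : ℝ)) =
      (if ∅ ⊆ U then 1 else 0) *
      ∏ Q ∈ H, (1 + (Real.exp s - 1) * (if B Q ⊆ U then 1 else 0)) := by
    intro U
    have : ∀ Q, (1 + (Real.exp s - 1) * (if B Q ⊆ U then (1:ℝ) else 0)) =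
      if B Q ⊆ U then Real.exp s else 1 := by intro Q; split_ifs <;> ring
    simp only [this]
    rw [Finset.prod_ite]
    simp [← Real.exp_nat_mul, mul_comm]
  simp only [e]
  rw [h]
  simp only [Finset.card_empty, pow_zero, one_mul]
  have hpj : p ^ j ≤ 1 := pow_le_one₀ h0 h1
  have hpj0 : 0 ≤ p ^ j := pow_nonneg h0 j
  calc (1 + (Real.exp s - 1) * p ^ j) ^ H.card
      ≤ (Real.exp ((Real.exp s - 1) * p ^ j)) ^ H.card := by
        apply pow_le_pow_left₀
        · nlinarith [Real.exp_pos s]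
        · linarith [Real.add_one_le_exp ((Real.exp s - 1) * p ^ j)]
    _ = _ := by rw [← Real.exp_nat_mul]; congr 1; ring

lemma swt_mgf {n : ℕ} {ι : Type*} {p : ℝ} (h0 : 0 ≤ p) (h1 : p ≤ 1) (s : ℝ) (j χ : ℕ)
    (hχ : 0 < χ) (col : ι → Fin χ)
    (B : ι → Finset (Fin n)) (H : Finset ι) (hj : ∀ Q ∈ H, (B Q).card = j)
    (hd : ∀ Q ∈ H, ∀ Q' ∈ H, Q ≠ Q' → col Q = col Q' → Disjoint (B Q) (B Q')) :
    ∑ U : Finset (Fin n), swt n p U *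
        Real.exp (s / χ * ((H.filter fun Q => B Q ⊆ U).card : ℝ))
      ≤ Real.exp (p ^ j * H.card * (Real.exp s - 1) / χ) := by
  have hχ' : (0:ℝ) < χ := by exact_mod_cast hχ
  set Hc : Fin χ → Finset ι := fun c => H.filter fun Q => col Q = c with hHc
  have hsum : ∑ c, ((Hc c).card : ℝ) = H.card := by
    have := Finset.card_eq_sum_card_fiberwise (s := H) (t := Finset.univ) (f := col)
      (fun _ _ => by simp)
    rw [this]; push_cast; rfl
  have hsumU : ∀ U : Finset (Fin n), ∑ c, (((Hc c).filter fun Q => B Q ⊆ U).card : ℝ)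
      = ((H.filter fun Q => B Q ⊆ U).card : ℝ) := by
    intro U
    have := Finset.card_eq_sum_card_fiberwise (s := H.filter fun Q => B Q ⊆ U)
      (t := Finset.univ) (f := col) (fun _ _ => by simp)
    rw [this]; push_cast
    refine Finset.sum_congr rfl fun c _ => ?_
    rw [hHc]; simp only [Finset.filter_filter]
    congr 2; ext Q; simp; tauto
  set K : ℝ := p ^ j * (Real.exp s - 1) with hK
  have key : ∀ U : Finset (Fin n),
      Real.exp (s / χ * ((H.filter fun Q => B Q ⊆ U).card : ℝ)
        - p ^ j * H.card * (Real.exp s - 1) / χ)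
      ≤ ∑ c, (1 / (χ:ℝ)) * (Real.exp (- (K * (Hc c).card)) *
          Real.exp (s * (((Hc c).filter fun Q => B Q ⊆ U).card : ℝ))) := by
    intro U
    have := convexOn_exp.map_sum_le (t := Finset.univ) (w := fun _ : Fin χ => 1 / (χ:ℝ))
      (p := fun c => -(K * (Hc c).card) + s * (((Hc c).filter fun Q => B Q ⊆ U).card : ℝ))
      (fun _ _ => by positivity) (by simp [hχ'.ne']) (fun _ _ => Set.mem_univ _)
    simp only [smul_eq_mul] at this
    rw [← Finset.mul_sum, Finset.sum_add_distrib, Finset.sum_neg_distrib, ← Finset.mul_sum,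
      ← Finset.mul_sum, hsum, hsumU] at this
    simp only [Real.exp_add] at this
    refine le_trans (le_of_eq ?_) this
    congr 1
    rw [hK]; field_simp; ring
  have : ∑ U : Finset (Fin n), swt n p U *
      Real.exp (s / χ * ((H.filter fun Q => B Q ⊆ U).card : ℝ)
        - p ^ j * H.card * (Real.exp s - 1) / χ) ≤ 1 := by
    calc _ ≤ ∑ U : Finset (Fin n), swt n p U *
          ∑ c, (1 / (χ:ℝ)) * (Real.exp (- (K * (Hc c).card)) *
          Real.exp (s * (((Hc c).filter fun Q => B Q ⊆ U).card : ℝ))) :=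
          Finset.sum_le_sum fun U _ => mul_le_mul_of_nonneg_left (key U) (swt_nonneg h0 h1 U)
      _ = ∑ c, (1 / (χ:ℝ)) * (Real.exp (- (K * (Hc c).card)) *
          ∑ U : Finset (Fin n), swt n p U *
            Real.exp (s * (((Hc c).filter fun Q => B Q ⊆ U).card : ℝ))) := by
          simp only [Finset.mul_sum]
          rw [Finset.sum_comm]
          refine Finset.sum_congr rfl fun c _ => Finset.sum_congr rfl fun U _ => ?_
          ring
      _ ≤ ∑ c : Fin χ, (1 / (χ:ℝ)) * 1 := by
          refine Finset.sum_le_sum fun c _ => ?_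
          apply mul_le_mul_of_nonneg_left _ (by positivity)
          have := swt_mgf_disj h0 h1 s j B (Hc c)
            (fun Q hQ => hj Q (Finset.mem_filter.1 hQ).1)
            (fun Q hQ Q' hQ' hne => hd Q (Finset.mem_filter.1 hQ).1 Q' (Finset.mem_filter.1 hQ').1
              hne ((Finset.mem_filter.1 hQ).2.trans (Finset.mem_filter.1 hQ').2.symm))
          calc _ ≤ Real.exp (- (K * (Hc c).card)) *
                Real.exp (p ^ j * (Hc c).card * (Real.exp s - 1)) :=
                mul_le_mul_of_nonneg_left this (Real.exp_pos _).le
            _ = 1 := by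
                rw [← Real.exp_add, Real.exp_eq_one_iff, hK]; ring
      _ = 1 := by simp [hχ'.ne']
  have h2 : ∑ U : Finset (Fin n), swt n p U *
        Real.exp (s / χ * ((H.filter fun Q => B Q ⊆ U).card : ℝ))
      = Real.exp (p ^ j * H.card * (Real.exp s - 1) / χ) *
       ∑ U : Finset (Fin n), swt n p U *
      Real.exp (s / χ * ((H.filter fun Q => B Q ⊆ U).card : ℝ)
        - p ^ j * H.card * (Real.exp s - 1) / χ) := by
    rw [Finset.mul_sum]
    refine Finset.sum_congr rfl fun U _ => ?_
    rw [Real.exp_sub]; field_simp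
  rw [h2]
  calc _ ≤ Real.exp (p ^ j * H.card * (Real.exp s - 1) / χ) * 1 :=
        mul_le_mul_of_nonneg_left this (Real.exp_pos _).le
    _ = _ := mul_one _

lemma exists_col {ι : Type*} (conf : ι → ι → Prop) (hs : ∀ a b, conf a b → conf b a)
    (χ : ℕ) (hχ : 0 < χ) (F : Finset ι)
    (hF : ∀ Q ∈ F, (F.filter fun Q' => Q' ≠ Q ∧ conf Q Q').card < χ) :
    ∃ col : ι → Fin χ, ∀ Q ∈ F, ∀ Q' ∈ F, Q ≠ Q' → col Q = col Q' → ¬ conf Q Q' := by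
  induction F using Finset.induction_on with
  | empty => exact ⟨fun _ => ⟨0, hχ⟩, by simp⟩
  | insert R F hR ih =>
    obtain ⟨col, hcol⟩ := ih (fun Q hQ => lt_of_le_of_lt (Finset.card_le_card
      (Finset.filter_subset_filter _ (Finset.subset_insert _ _)))
      (hF Q (Finset.mem_insert_of_mem hQ)))
    have h1 := hF R (Finset.mem_insert_self _ _)
    obtain ⟨c, hc⟩ : ∃ c : Fin χ, c ∉ ((insert R F).filter fun Q' => Q' ≠ R ∧ conf R Q').image col := by
      by_contra hcon
      push Not at hcon
      have : (Finset.univ : Finset (Fin χ)) ⊆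
        ((insert R F).filter fun Q' => Q' ≠ R ∧ conf R Q').image col := fun c _ => hcon c
      have := (Finset.card_le_card this).trans Finset.card_image_le
      simp only [Finset.card_univ, Fintype.card_fin] at this
      omega
    have hc' : ∀ Q ∈ F, conf R Q → col Q ≠ c := by
      intro Q hQ hconf he
      apply hc
      rw [Finset.mem_image]
      refine ⟨Q, Finset.mem_filter.2 ⟨Finset.mem_insert_of_mem hQ, ?_, hconf⟩, he⟩
      rintro rfl; exact hR hQ
    refine ⟨fun Q => if Q = R then c else col Q, ?_⟩
    intro Q hQ Q' hQ' hne he hconf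
    rcases Finset.mem_insert.1 hQ with rfl | hQ1
    · rcases Finset.mem_insert.1 hQ' with rfl | hQ1'
      · exact hne rfl
      · simp [hne.symm] at he
        exact hc' Q' hQ1' hconf he.symm
    · have hQR : Q ≠ R := by rintro rfl; exact hR hQ1
      rcases Finset.mem_insert.1 hQ' with rfl | hQ1'
      · simp [hQR] at he
        exact hc' Q hQ1 (hs _ _ hconf) he
      · have hQR' : Q' ≠ R := by rintro rfl; exact hR hQ1'
        simp [hQR, hQR'] at he
        exact hcol Q hQ1 Q' hQ1' hne he hconf

lemma sampleProb_le_exp {n : ℕ} {p : ℝ} (h0 : 0 ≤ p) (h1 : p ≤ 1) (E : Finset (Fin n) → Prop)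
    (g : Finset (Fin n) → ℝ) (hg : ∀ U, E U → 1 ≤ g U) (hg0 : ∀ U, 0 ≤ g U) :
    sampleProb n p E ≤ ∑ U, swt n p U * g U := by
  unfold sampleProb
  calc _ ≤ ∑ R ∈ Finset.univ.filter E, swt n p R * g R := by
        refine Finset.sum_le_sum fun R hR => ?_
        have := hg R (Finset.mem_filter.1 hR).2
        have h2 := swt_nonneg h0 h1 R
        change swt n p R ≤ _
        nlinarith
    _ ≤ _ := Finset.sum_le_sum_of_subset_of_nonneg (Finset.filter_subset _ _)
        fun R _ _ => mul_nonneg (swt_nonneg h0 h1 R) (hg0 R)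

lemma sampleProb_compl {n : ℕ} {p : ℝ} (E : Finset (Fin n) → Prop) :
    sampleProb n p E = 1 - sampleProb n p (fun U => ¬ E U) := by
  have h := swt_super p (∅ : Finset (Fin n))
  simp only [Finset.empty_subset, if_true, mul_one, Finset.card_empty, pow_zero] at h
  have h2 := Finset.sum_filter_add_sum_filter_not (Finset.univ) E (fun U => swt n p U)
  rw [h] at h2
  have h3 : sampleProb n p E + sampleProb n p (fun U => ¬ E U) = 1 := by
    rw [← h2]
    unfold sampleProb swt
    congr!
  linarith

lemma sampleProb_exists_le {n : ℕ} {p : ℝ} (h0 : 0 ≤ p) (h1 : p ≤ 1) {τ : Type*} [Fintype τ]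
    (E : Finset (Fin n) → Prop) (G : τ → Finset (Fin n) → Prop)
    (h : ∀ U, E U → ∃ t, G t U) :
    sampleProb n p E ≤ ∑ t, sampleProb n p (G t) := by
  have : ∀ t, sampleProb n p (G t) = ∑ U, swt n p U * (if G t U then 1 else 0) := by
    intro t; unfold sampleProb; rw [Finset.sum_filter]
    refine Finset.sum_congr rfl fun U _ => ?_
    split_ifs <;> simp [swt]
  simp only [this]
  rw [Finset.sum_comm]
  simp only [← Finset.mul_sum]
  apply sampleProb_le_exp h0 h1
  · intro U hU
    obtain ⟨t, ht⟩ := h U hU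
    have := Finset.single_le_sum (f := fun t => if G t U then (1:ℝ) else 0)
      (fun i _ => by split_ifs <;> norm_num) (Finset.mem_univ t)
    simpa [ht] using this
  · intro U
    exact Finset.sum_nonneg fun i _ => by split_ifs <;> norm_num

lemma exp_neg_small {x : ℝ} (hx : 2.4 ≤ x) : Real.exp (-x) ≤ 1/10 := by
  rw [Real.exp_neg, inv_eq_one_div]
  apply one_div_le_one_div_of_le (by norm_num)
  have h1 : Real.exp 2.4 ≤ Real.exp x := Real.exp_le_exp.2 hx
  have h2 : Real.exp 2.4 = Real.exp 1 ^ 2 * Real.exp 0.4 := by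
    rw [← Real.exp_nat_mul, ← Real.exp_add]; norm_num
  have h3 := Real.exp_one_gt_d9
  have h4 := Real.quadratic_le_exp_of_nonneg (x := 0.4) (by norm_num)
  have h5 : (2.7182818283:ℝ)^2 ≤ Real.exp 1 ^ 2 := by gcongr
  have h6 : (2.7182818283:ℝ)^2 * 1.48 ≤ Real.exp 1 ^ 2 * Real.exp 0.4 := by
    apply mul_le_mul h5 (by linarith) (by norm_num) (by positivity)
  norm_num at h6 ⊢
  rw [h2] at h1
  norm_num at h1
  linarith

lemma final_lemma {n : ℕ} {Ξ : Type*} [Fintype Ξ] {p : ℝ} (h0 : 0 < p) (h1 : p ≤ 1)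
    (hΞ : 2 ≤ Fintype.card Ξ)
    (C : Finset (Fin n)) (F : Finset (Finset (Fin n))) (j χ : ℕ) (hχ : 0 < χ)
    (hj : ∀ Q ∈ F, (Q \ C).card = j) (col : Finset (Fin n) → Fin χ)
    (hcol : ∀ Q ∈ F, ∀ Q' ∈ F, Q ≠ Q' → col Q = col Q' → Disjoint (Q \ C) (Q' \ C))
    (S : Finset (Fin n) → (Fin n → Ξ) → ℝ)
    (hloc : ∀ Q (w w' : Fin n → Ξ), (∀ i ∈ Q, w i = w' i) → S Q w = S Q w')
    (Good Bad : (Fin n → Ξ) → Prop)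
    (hgood : ∀ w, Good w → 0.9 * (F.card : ℝ) ≤ ((F.filter fun Q => S Q w = 1).card : ℝ))
    (hbad : ∀ w, Bad w → ∀ u : Fin n → Ξ, (∀ i, i ∉ C → u i = w i) →
      ((F.filter fun Q => S Q u = 1).card : ℝ) ≤ 0.1 * (F.card : ℝ))
    (hbig : C.card * Real.log (Fintype.card Ξ) + 2.4 ≤ 0.15 * (p ^ j * F.card / χ)) :
    ∃ A : Finset (Fin n) → (Fin n → Ξ) → Bool,
      (∀ U : Finset (Fin n), ∀ w w' : Fin n → Ξ,
        (∀ i ∈ U, w i = w' i) → A U w = A U w') ∧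
      (∀ w, Good w → 1 - 1/10 ≤ sampleProb n p (fun U => A U w = true)) ∧
      (∀ w, Bad w → sampleProb n p (fun U => A U w = true) ≤ 1/10) := by
  have hχ' : (0:ℝ) < χ := by exact_mod_cast hχ
  have hM : (0:ℝ) < Fintype.card Ξ := by
    have : 0 < Fintype.card Ξ := by omega
    exact_mod_cast this
  have hlog : 0 ≤ Real.log (Fintype.card Ξ) := Real.log_natCast_nonneg _
  set X : (Fin n → Ξ) → Finset (Fin n) → ℝ := fun u U =>
    (((F.filter fun Q => S Q u = 1).filter fun Q => Q \ C ⊆ U).card : ℝ) with hX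
  set T : ℝ := 0.4 * (p ^ j * F.card) with hT
  set Y : ℝ := p ^ j * F.card / χ with hY
  have hYT : T / χ = 0.4 * Y := by rw [hT, hY]; ring
  have hY0 : 0 ≤ Y := by positivity
  have mgf : ∀ (s : ℝ) (u : Fin n → Ξ), ∑ U : Finset (Fin n), swt n p U *
      Real.exp (s / χ * X u U - s * (0.4 * Y))
      ≤ Real.exp (p ^ j * (F.filter fun Q => S Q u = 1).card * (Real.exp s - 1) / χ
        - s * (0.4 * Y)) := by
    intro s u
    have := swt_mgf h0.le h1 s j χ hχ col (fun Q => Q \ C) (F.filter fun Q => S Q u = 1)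
      (fun Q hQ => hj Q (Finset.mem_filter.1 hQ).1)
      (fun Q hQ Q' hQ' => hcol Q (Finset.mem_filter.1 hQ).1 Q' (Finset.mem_filter.1 hQ').1)
    have h2 : ∀ U : Finset (Fin n), swt n p U * Real.exp (s / χ * X u U - s * (0.4 * Y)) =
        (swt n p U * Real.exp (s / χ * X u U)) * Real.exp (- (s * (0.4 * Y))) := by
      intro U; rw [sub_eq_add_neg, Real.exp_add]; ring
    simp only [h2]
    rw [← Finset.sum_mul, sub_eq_add_neg, Real.exp_add]
    exact mul_le_mul_of_nonneg_right this (Real.exp_pos _).le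
  refine ⟨fun U w => decide (∃ u : Fin n → Ξ, (∀ i ∈ U, i ∉ C → u i = w i) ∧ T ≤ X u U),
    ?_, ?_, ?_⟩
  · intro U w w' h
    have : (∃ u : Fin n → Ξ, (∀ i ∈ U, i ∉ C → u i = w i) ∧ T ≤ X u U) ↔
      (∃ u : Fin n → Ξ, (∀ i ∈ U, i ∉ C → u i = w' i) ∧ T ≤ X u U) := by
      constructor
      · rintro ⟨u, hu, hT⟩
        exact ⟨u, fun i hi hC => (hu i hi hC).trans (h i hi), hT⟩
      · rintro ⟨u, hu, hT⟩
        exact ⟨u, fun i hi hC => (hu i hi hC).trans (h i hi).symm, hT⟩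
    simp only [this]
  · intro w hw
    rw [sampleProb_compl]
    have hA : sampleProb n p (fun U => ¬ (decide (∃ u : Fin n → Ξ,
        (∀ i ∈ U, i ∉ C → u i = w i) ∧ T ≤ X u U) = true)) ≤ 1/10 := by
      calc _ ≤ ∑ U, swt n p U * Real.exp ((-1 : ℝ) / χ * X w U - (-1) * (0.4 * Y)) := by
            apply sampleProb_le_exp h0.le h1 _ _ _ (fun U => (Real.exp_pos _).le)
            intro U hU
            simp only [decide_eq_true_eq, not_exists, not_and, not_le] at hU
            have := hU w (fun _ _ _ => rfl)
            rw [Real.one_le_exp_iff, ← hYT]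
            have : X w U / χ ≤ T / χ := by gcongr
            have e : (-1 : ℝ) / χ * X w U - (-1) * (T / χ) = T / χ - X w U / χ := by ring
            linarith
        _ ≤ _ := mgf (-1) w
        _ ≤ Real.exp (-2.4) := by
            apply Real.exp_le_exp.2
            have hg := hgood w hw
            have he : Real.exp (-1) ≤ 0.3679 := by
              have := Real.exp_neg_one_lt_d9; linarith
            have h3 : 0.9 * Y ≤ p ^ j * (F.filter fun Q => S Q w = 1).card / χ := by
              rw [hY]
              calc 0.9 * (p ^ j * F.card / χ) = p ^ j * (0.9 * F.card) / χ := by ring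
                _ ≤ _ := by gcongr
            have e : p ^ j * (F.filter fun Q => S Q w = 1).card * (Real.exp (-1) - 1) / χ
              = (p ^ j * (F.filter fun Q => S Q w = 1).card / χ) * (Real.exp (-1) - 1) := by ring
            rw [e]
            have : 0 ≤ (C.card : ℝ) * Real.log (Fintype.card Ξ) := by positivity
            nlinarith
        _ ≤ 1/10 := exp_neg_small le_rfl
    linarith
  · intro w hw
    set uσ : (C → Ξ) → (Fin n → Ξ) := fun σ i => if h : i ∈ C then σ ⟨i, h⟩ else w i with huσ
    have hone : ∀ σ, sampleProb n p (fun U => T ≤ X (uσ σ) U) ≤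
        Real.exp (-(C.card * Real.log (Fintype.card Ξ))) * (1/10) := by
      intro σ
      calc _ ≤ ∑ U, swt n p U * Real.exp ((1 : ℝ) / χ * X (uσ σ) U - 1 * (0.4 * Y)) := by
            apply sampleProb_le_exp h0.le h1 _ _ _ (fun U => (Real.exp_pos _).le)
            intro U hU
            rw [Real.one_le_exp_iff, ← hYT]
            have : T / χ ≤ X (uσ σ) U / χ := by gcongr
            have e : (1 : ℝ) / χ * X (uσ σ) U - 1 * (T / χ) = X (uσ σ) U / χ - T / χ := by ring
            linarith
        _ ≤ _ := mgf 1 (uσ σ)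
        _ ≤ Real.exp (-(C.card * Real.log (Fintype.card Ξ)) + (-2.4)) := by
            apply Real.exp_le_exp.2
            have hg := hbad w hw (uσ σ) (fun i hi => by simp [huσ, hi])
            have he : Real.exp 1 ≤ 2.72 := by
              have := Real.exp_one_lt_d9; linarith
            have he1 : 1 ≤ Real.exp 1 := Real.one_le_exp (by norm_num)
            have h3 : p ^ j * (F.filter fun Q => S Q (uσ σ) = 1).card / χ ≤ 0.1 * Y := by
              rw [hY]
              calc _ ≤ p ^ j * (0.1 * F.card) / χ := by gcongr
                _ = 0.1 * (p ^ j * F.card / χ) := by ring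
            have e : p ^ j * (F.filter fun Q => S Q (uσ σ) = 1).card * (Real.exp 1 - 1) / χ
              = (p ^ j * (F.filter fun Q => S Q (uσ σ) = 1).card / χ) * (Real.exp 1 - 1) := by ring
            rw [e]
            nlinarith
        _ ≤ _ := by
            rw [Real.exp_add]
            exact mul_le_mul_of_nonneg_left (exp_neg_small le_rfl) (Real.exp_pos _).le
    calc _ ≤ ∑ σ : C → Ξ, sampleProb n p (fun U => T ≤ X (uσ σ) U) := by
          apply sampleProb_exists_le h0.le h1
          intro U hU
          simp only [decide_eq_true_eq] at hU
          obtain ⟨u, hu, hTu⟩ := hU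
          refine ⟨fun i => u i, hTu.trans (le_of_eq ?_)⟩
          simp only [hX, Finset.filter_filter]
          congr 2
          apply Finset.filter_congr
          intro Q hQ
          have : Q \ C ⊆ U → S Q u = S Q (uσ fun i => u i) := by
            intro hQU
            apply hloc
            intro i hi
            by_cases hC : i ∈ C
            · simp [huσ, hC]
            · simp only [huσ, hC, dite_false]
              exact hu i (hQU (Finset.mem_sdiff.2 ⟨hi, hC⟩)) hC
          constructor
          · rintro ⟨a, b⟩; exact ⟨(this b).symm.trans a, b⟩
          · rintro ⟨a, b⟩; exact ⟨(this b).trans a, b⟩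
      _ ≤ ∑ σ : C → Ξ, Real.exp (-(C.card * Real.log (Fintype.card Ξ))) * (1/10) :=
          Finset.sum_le_sum fun σ _ => hone σ
      _ = 1/10 := by
          rw [Finset.sum_const, Finset.card_univ, Fintype.card_fun, Fintype.card_coe,
            nsmul_eq_mul, Real.exp_neg, Real.exp_nat_mul, Real.exp_log hM]
          push_cast
          field_simp

/-- degree of a coordinate in a set family -/
def fdeg {n : ℕ} (V : Finset (Finset (Fin n))) (i : Fin n) : ℕ := (V.filter fun Q => i ∈ Q).card

/-- coordinates of high degree -/
def hiSet {n : ℕ} (V : Finset (Finset (Fin n))) (D : ℝ) : Finset (Fin n) :=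
  Finset.univ.filter fun i => D ≤ (fdeg V i : ℝ)

lemma sum_fdeg {n q : ℕ} (V : Finset (Finset (Fin n))) (hV : ∀ Q ∈ V, Q.card = q) :
    ∑ i, fdeg V i = V.card * q := by
  unfold fdeg
  have h := Finset.sum_card_bipartiteAbove_eq_sum_card_bipartiteBelow
    (s := (Finset.univ : Finset (Fin n))) (t := V) (fun (i : Fin n) (Q : Finset (Fin n)) => i ∈ Q)
  have h2 : ∑ i : Fin n, (V.filter fun Q => i ∈ Q).card = ∑ Q ∈ V, Q.card := by
    simpa [Finset.bipartiteAbove, Finset.bipartiteBelow] using h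
  rw [h2]
  rw [Finset.sum_congr rfl hV]; simp

lemma hiSet_card {n q : ℕ} (V : Finset (Finset (Fin n))) (hV : ∀ Q ∈ V, Q.card = q) (D : ℝ) :
    ((hiSet V D).card : ℝ) * D ≤ q * V.card := by
  have h := sum_fdeg V hV
  have h' : ∑ i, (fdeg V i : ℝ) = V.card * q := by exact_mod_cast h
  calc ((hiSet V D).card : ℝ) * D = ∑ i ∈ hiSet V D, D := by simp
    _ ≤ ∑ i ∈ hiSet V D, (fdeg V i : ℝ) :=
        Finset.sum_le_sum fun i hi => (Finset.mem_filter.1 hi).2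
    _ ≤ ∑ i, (fdeg V i : ℝ) := Finset.sum_le_sum_of_subset_of_nonneg (Finset.subset_univ _)
        fun _ _ _ => by positivity
    _ = _ := by rw [h']; ring

lemma hiSet_anti {n : ℕ} (V : Finset (Finset (Fin n))) {D D' : ℝ} (h : D ≤ D') :
    hiSet V D' ⊆ hiSet V D := by
  intro i hi
  simp only [hiSet, Finset.mem_filter, Finset.mem_univ, true_and] at hi ⊢
  linarith

lemma exists_gap {n q : ℕ} (V : Finset (Finset (Fin n))) (D0 r : ℝ) (hD0 : 0 < D0) (hr : 1 ≤ r)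
    (Q : Finset (Fin n)) (hQ : Q.card = q) (hQ0 : ¬ Q ⊆ hiSet V D0) :
    ∃ k < q, ∀ i ∈ Q, i ∉ hiSet V (D0 * r ^ (k+1)) → (fdeg V i : ℝ) < D0 * r ^ k := by
  by_contra hcon
  push Not at hcon
  simp only [hiSet, Finset.mem_filter, Finset.mem_univ, true_and, not_le] at hcon
  obtain ⟨i0, _, _⟩ := Finset.not_subset.1 hQ0
  have : Nonempty (Fin n) := ⟨i0⟩
  choose! f hf using hcon
  have hmono : ∀ a b : ℕ, a ≤ b → D0 * r ^ a ≤ D0 * r ^ b := fun a b hab =>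
    mul_le_mul_of_nonneg_left (pow_le_pow_right₀ hr hab) hD0.le
  have hinj : Set.InjOn f (Finset.range q : Finset ℕ) := by
    intro a ha b hb hab
    simp only [Finset.coe_range, Set.mem_Iio] at ha hb
    have h1 := (hf a ha).2
    have h2 := (hf b hb).2
    rw [hab] at h1
    by_contra hne
    rcases lt_or_gt_of_ne hne with h | h
    · have := hmono (a+1) b h; linarith
    · have := hmono (b+1) a h; linarith
  have hmaps : ∀ a ∈ Finset.range q, f a ∈ Q.filter fun i => i ∈ hiSet V D0 := by
    intro a ha
    have ha' := Finset.mem_range.1 ha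
    refine Finset.mem_filter.2 ⟨(hf a ha').1, ?_⟩
    simp only [hiSet, Finset.mem_filter, Finset.mem_univ, true_and]
    have := hmono 0 a (Nat.zero_le _)
    simp only [pow_zero, mul_one] at this
    linarith [(hf a ha').2]
  have hc := Finset.card_le_card_of_injOn f hmaps hinj
  rw [Finset.card_range] at hc
  obtain ⟨i, hi, hiQ⟩ := Finset.not_subset.1 hQ0
  have : (Q.filter fun i => i ∈ hiSet V D0).card < Q.card := by
    apply Finset.card_lt_card
    refine ⟨Finset.filter_subset _ _, fun h => ?_⟩
    exact hiQ (Finset.mem_filter.1 (h hi)).2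
  omega

lemma exists_family {n q : ℕ} (hq : 0 < q) (V : Finset (Finset (Fin n)))
    (hV : ∀ Q ∈ V, Q.card = q)
    (D0 r : ℝ) (hD0 : 0 < D0) (hr : 1 ≤ r) :
    ∃ k < q, ∃ j, 1 ≤ j ∧ j ≤ q ∧ ∃ F ⊆ V,
      ((V.filter fun Q => ¬ Q ⊆ hiSet V D0).card ≤ q ^ 2 * F.card) ∧
      (∀ Q ∈ F, (Q \ hiSet V (D0 * r ^ (k+1))).card = j) ∧
      (∀ Q ∈ F, ∀ i ∈ Q, i ∉ hiSet V (D0 * r ^ (k+1)) → (fdeg V i : ℝ) < D0 * r ^ k) := by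
  have hex : ∀ Q ∈ V.filter (fun Q => ¬ Q ⊆ hiSet V D0),
    ∃ k < q, ∀ i ∈ Q, i ∉ hiSet V (D0 * r ^ (k+1)) → (fdeg V i : ℝ) < D0 * r ^ k := by
    intro Q hQ
    rw [Finset.mem_filter] at hQ
    exact exists_gap V D0 r hD0 hr Q (hV Q hQ.1) hQ.2
  choose! kk hk1 hk2 using hex
  set G := V.filter (fun Q => ¬ Q ⊆ hiSet V D0) with hG
  set g : Finset (Fin n) → ℕ × ℕ := fun Q => (kk Q, (Q \ hiSet V (D0 * r ^ (kk Q+1))).card)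
  have hmaps : ∀ Q ∈ G, g Q ∈ Finset.range q ×ˢ Finset.Icc 1 q := by
    intro Q hQ
    have hQ' := Finset.mem_filter.1 hQ
    rw [Finset.mem_product, Finset.mem_range, Finset.mem_Icc]
    refine ⟨hk1 Q hQ, ?_, ?_⟩
    · rw [Nat.one_le_iff_ne_zero, ne_eq, Finset.card_eq_zero, Finset.sdiff_eq_empty_iff_subset]
      intro h
      apply hQ'.2
      refine h.trans (hiSet_anti V ?_)
      have : 1 ≤ r ^ (kk Q + 1) := one_le_pow₀ hr
      nlinarith
    · calc _ ≤ Q.card := Finset.card_le_card Finset.sdiff_subset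
        _ = q := hV Q hQ'.1
  have hne : (Finset.range q ×ˢ Finset.Icc 1 q).Nonempty :=
    ⟨(0, 1), by rw [Finset.mem_product, Finset.mem_range, Finset.mem_Icc]; simp; omega⟩
  have hcard := Finset.card_eq_sum_card_fiberwise hmaps
  obtain ⟨⟨k, j⟩, hkj, hle⟩ := Finset.exists_max_image (Finset.range q ×ˢ Finset.Icc 1 q)
    (fun y => (G.filter fun Q => g Q = y).card) hne
  rw [Finset.mem_product, Finset.mem_range, Finset.mem_Icc] at hkj
  refine ⟨k, hkj.1, j, hkj.2.1, hkj.2.2, G.filter (fun Q => g Q = (k, j)), ?_, ?_, ?_, ?_⟩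
  · exact (Finset.filter_subset _ _).trans (Finset.filter_subset _ _)
  · rw [hcard]
    calc _ ≤ ∑ y ∈ Finset.range q ×ˢ Finset.Icc 1 q, (G.filter fun Q => g Q = (k, j)).card :=
          Finset.sum_le_sum hle
      _ = _ := by simp [sq]
  · intro Q hQ
    have := (Finset.mem_filter.1 hQ).2
    simp only [g, Prod.mk.injEq] at this
    rw [← this.1]; exact this.2
  · intro Q hQ
    have := (Finset.mem_filter.1 hQ).2
    simp only [g, Prod.mk.injEq] at this
    rw [← this.1]; exact hk2 Q (Finset.mem_filter.1 hQ).1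

lemma exists_family_col {n q : ℕ} (V F : Finset (Finset (Fin n)))
    (hFV : F ⊆ V) (hV : ∀ Q ∈ V, Q.card = q) (C : Finset (Fin n)) (D : ℝ) (hD : 0 ≤ D)
    (hdeg : ∀ Q ∈ F, ∀ i ∈ Q, i ∉ C → (fdeg V i : ℝ) < D) :
    ∃ col : Finset (Fin n) → Fin (⌊q * D⌋₊ + 1),
      ∀ Q ∈ F, ∀ Q' ∈ F, Q ≠ Q' → col Q = col Q' → Disjoint (Q \ C) (Q' \ C) := by
  have hmain : ∀ Q ∈ F, (F.filter fun Q' => Q' ≠ Q ∧ ¬ Disjoint (Q \ C) (Q' \ C)).card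
      < ⌊q * D⌋₊ + 1 := by
    intro Q hQ
    rw [Nat.lt_succ_iff]
    apply Nat.le_floor
    have hsub : (F.filter fun Q' => Q' ≠ Q ∧ ¬ Disjoint (Q \ C) (Q' \ C)) ⊆
        (Q \ C).biUnion fun i => V.filter fun Q' => i ∈ Q' := by
      intro Q' hQ'
      rw [Finset.mem_filter, Finset.not_disjoint_iff] at hQ'
      obtain ⟨h1, _, i, hi, hi'⟩ := hQ'
      rw [Finset.mem_biUnion]
      exact ⟨i, hi, Finset.mem_filter.2 ⟨hFV h1, (Finset.mem_sdiff.1 hi').1⟩⟩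
    have h1 := (Finset.card_le_card hsub).trans Finset.card_biUnion_le
    have h2 : ((F.filter fun Q' => Q' ≠ Q ∧ ¬ Disjoint (Q \ C) (Q' \ C)).card : ℝ) ≤
      ∑ i ∈ Q \ C, (fdeg V i : ℝ) := by exact_mod_cast h1
    calc _ ≤ _ := h2
      _ ≤ ∑ i ∈ Q \ C, D := Finset.sum_le_sum fun i hi =>
          (hdeg Q hQ i (Finset.mem_sdiff.1 hi).1 (Finset.mem_sdiff.1 hi).2).le
      _ = (Q \ C).card * D := by simp
      _ ≤ q * D := by
          have : (Q \ C).card ≤ q := by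
            rw [← hV Q (hFV hQ)]; exact Finset.card_le_card Finset.sdiff_subset
          gcongr
  obtain ⟨col, hcol⟩ := exists_col (fun Q Q' : Finset (Fin n) => ¬ Disjoint (Q \ C) (Q' \ C))
    (fun a b h h' => h h'.symm) (⌊q * D⌋₊ + 1) (Nat.succ_pos _) F (by convert hmain)
  exact ⟨col, fun Q hQ Q' hQ' hne he => not_not.1 (hcol Q hQ Q' hQ' hne he)⟩

lemma supp_mu {n : ℕ} {Ξ : Type*} (P : ProbFormula n Ξ) (hu : P.Uniform) :
    ∀ Q ∈ P.supp, (P.supp.card : ℝ) * P.μ Q = 1 := by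
  intro Q hQ
  have hQ' := (Finset.mem_filter.1 hQ).2
  have h : ∑ R ∈ P.supp, P.μ R = 1 := by
    rw [← P.μ_sum]
    apply Finset.sum_subset (Finset.subset_univ _)
    intro R _ hR
    have : ¬ 0 < P.μ R := fun h => hR (Finset.mem_filter.2 ⟨Finset.mem_univ _, h⟩)
    exact le_antisymm (not_lt.1 this) (P.μ_nonneg R)
  have h2 : ∑ R ∈ P.supp, P.μ R = ∑ R ∈ P.supp, P.μ Q :=
    Finset.sum_congr rfl (fun R hR => hu R Q (Finset.mem_filter.1 hR).2 hQ')
  rw [← h, h2]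
  simp

lemma supp_pos {n : ℕ} {Ξ : Type*} (P : ProbFormula n Ξ) : 0 < P.supp.card := by
  rw [Finset.card_pos]
  by_contra h
  rw [Finset.not_nonempty_iff_eq_empty] at h
  have : ∑ Q, P.μ Q = 0 := by
    apply Finset.sum_eq_zero
    intro R _
    have : ¬ 0 < P.μ R := fun hh => by
      have : R ∈ P.supp := Finset.mem_filter.2 ⟨Finset.mem_univ _, hh⟩
      rw [h] at this; simp at this
    exact le_antisymm (not_lt.1 this) (P.μ_nonneg R)
  rw [P.μ_sum] at this
  norm_num at this

lemma sat_count {n : ℕ} {Ξ : Type*} (P : ProbFormula n Ξ) (hc : P.Combinatorial)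
    (w : Fin n → Ξ) :
    ((P.supp.filter fun Q => P.S Q w = 1).card : ℝ) = P.supp.card * P.sat w := by
  have h : P.sat w = ∑ Q ∈ P.supp, P.μ Q * P.S Q w := by
    unfold ProbFormula.sat
    symm
    apply Finset.sum_subset (Finset.subset_univ _)
    intro R _ hR
    have : ¬ 0 < P.μ R := fun h => hR (Finset.mem_filter.2 ⟨Finset.mem_univ _, h⟩)
    rw [le_antisymm (not_lt.1 this) (P.μ_nonneg R), zero_mul]
  rw [h, Finset.mul_sum, Finset.card_filter]
  push_cast
  refine Finset.sum_congr rfl fun Q hQ => ?_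
  rw [← mul_assoc, supp_mu P hc.2 Q hQ, one_mul]
  rcases hc.1 Q (Finset.mem_filter.1 hQ).2 w with h | h <;> simp [h]

lemma far_modify {n : ℕ} {Ξ : Type*} {ε : ℝ} {L : Set (Fin n → Ξ)} {w u : Fin n → Ξ}
    (hw : FarFrom ε w L) (C : Finset (Fin n)) (hC : (C.card : ℝ) ≤ ε / 2 * n)
    (hu : ∀ i, i ∉ C → u i = w i) : FarFrom (ε/2) u L := by
  intro v hv
  have h := hw v hv
  unfold FarWord at h ⊢
  have hsub : (Finset.univ.filter fun i => w i ≠ v i) ⊆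
      (Finset.univ.filter fun i => u i ≠ v i) ∪ C := by
    intro i hi
    rw [Finset.mem_union]
    by_cases hiC : i ∈ C
    · exact Or.inr hiC
    · left
      simpa [hu i hiC] using hi
  have h2 := (Finset.card_le_card hsub).trans (Finset.card_union_le _ _)
  have h3 : ((Finset.univ.filter fun i => w i ≠ v i).card : ℝ) ≤
    (Finset.univ.filter fun i => u i ≠ v i).card + C.card := by exact_mod_cast h2
  linarith

lemma contained_card {n : ℕ} {Ξ : Type*} {ε δ : ℝ} {L' L : Set (Fin n → Ξ)}
    (hnt : NontrivialPair ε L' L) (P : ProbFormula n Ξ) (hc : P.Combinatorial)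
    (htest : P.IsPartialTest (ε/2) δ L' L)
    (C : Finset (Fin n)) (hC : (C.card : ℝ) ≤ ε / 2 * n) :
    ((P.supp.filter fun Q => Q ⊆ C).card : ℝ) ≤ 2 * δ * P.supp.card := by
  obtain ⟨⟨w', hw'⟩, w0, hw0⟩ := hnt
  set u : Fin n → Ξ := fun i => if i ∈ C then w' i else w0 i with hu
  have hfar := far_modify (u := u) hw0 C hC (fun i hi => by simp [hu, hi])
  have h1 := htest.1 w' hw'
  have h2 := htest.2 u hfar
  have c1 := sat_count P hc w'
  have c2 := sat_count P hc u
  have hm : (0:ℝ) ≤ P.supp.card := by positivity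
  have c3 : ((P.supp.filter fun Q => P.S Q w' = 1).card : ℝ) +
      (P.supp.filter fun Q => ¬ P.S Q w' = 1).card = P.supp.card := by
    exact_mod_cast Finset.card_filter_add_card_filter_not (s := P.supp)
      (fun Q => P.S Q w' = 1)
  have hsub : (P.supp.filter fun Q => Q ⊆ C) ⊆ (P.supp.filter fun Q => P.S Q u = 1) ∪
      (P.supp.filter fun Q => ¬ P.S Q w' = 1) := by
    intro Q hQ
    rw [Finset.mem_filter] at hQ
    have : P.S Q u = P.S Q w' := P.S_local _ _ _ fun i hi => by simp [hu, hQ.2 hi]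
    rw [Finset.mem_union, Finset.mem_filter, Finset.mem_filter, this]
    by_cases h : P.S Q w' = 1
    · exact Or.inl ⟨hQ.1, h⟩
    · exact Or.inr ⟨hQ.1, h⟩
  have h4 : ((P.supp.filter fun Q => Q ⊆ C).card : ℝ) ≤
      (P.supp.filter fun Q => P.S Q u = 1).card +
      (P.supp.filter fun Q => ¬ P.S Q w' = 1).card := by
    exact_mod_cast (Finset.card_le_card hsub).trans (Finset.card_union_le _ _)
  nlinarith [mul_le_mul_of_nonneg_left h1 hm, mul_le_mul_of_nonneg_left h2 hm]

lemma numerics {q j : ℕ} {p r lnM D m N c χ : ℝ} (hq : 3 ≤ q) (hj : j ≤ q) (hp0 : 0 < p)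
    (hp1 : p ≤ 1) (hr0 : 0 < r) (hl : 0 < lnM) (hD : 0 < D) (hm : 0 < m) (hχ0 : 0 < χ)
    (hpr : p ^ q * r = 28 * (q:ℝ) ^ 4 * lnM)
    (hN : 53 / 54 * m ≤ (q:ℝ) ^ 2 * N) (hχ : χ ≤ 2 * q * D)
    (hc : c * (D * r) ≤ q * m) (hZ : 2.4 * (D * r) ≤ q * lnM * m) :
    c * lnM + 2.4 ≤ 0.15 * (p ^ j * N / χ) := by
  have hq0 : (0:ℝ) < q := by
    have : 0 < q := by omega
    exact_mod_cast this
  have hN0 : 53 / 54 * m / (q:ℝ) ^ 2 ≤ N := by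
    rw [div_le_iff₀ (by positivity)]; linarith
  set Z : ℝ := q * lnM * m / (D * r) with hZdef
  have h1 : c * lnM ≤ Z := by
    rw [hZdef, le_div_iff₀ (by positivity)]
    nlinarith
  have h2 : 2.4 ≤ Z := by
    rw [hZdef, le_div_iff₀ (by positivity)]
    exact hZ
  have hpq : p ^ q ≤ p ^ j := pow_le_pow_of_le_one hp0.le hp1 hj
  have hN1 : 0 < N := lt_of_lt_of_le (by positivity) hN0
  have h3 : p ^ q * (53 / 54 * m / (q:ℝ) ^ 2) / (2 * q * D) ≤ p ^ j * N / χ := by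
    gcongr
  have h4 : p ^ q = 28 * (q:ℝ) ^ 4 * lnM / r := by
    rw [eq_div_iff hr0.ne']; exact hpr
  have h5 : p ^ q * (53 / 54 * m / (q:ℝ) ^ 2) / (2 * q * D) = 28 * 53 / 108 * Z := by
    rw [h4, hZdef]; field_simp; norm_num
  rw [h5] at h3
  linarith

lemma numerics2 {q : ℕ} {p α r lnM ε x : ℝ} (hq : 3 ≤ q) (hε : 0 < ε) (hε1 : ε ≤ 1)
    (hl : 0.69 ≤ lnM) (hx : 0 < x) (hp0 : 0 < p)
    (hα : α = 10 ^ 3 * lnM * (q:ℝ) ^ 4 / ε) (hpx : p ^ (q ^ 2) * x = α ^ (q ^ 2))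
    (hr : r = 28 * (q:ℝ) ^ 4 * lnM / p ^ q) :
    2.4 * (2 * r ^ q) ≤ lnM * (ε * x) := by
  have hq0 : (3:ℝ) ≤ q := by exact_mod_cast hq
  have hq4 : (81:ℝ) ≤ (q:ℝ) ^ 4 := by
    calc (81:ℝ) = 3 ^ 4 := by norm_num
      _ ≤ _ := by gcongr
  have hl0 : 0 < lnM := by linarith
  have hα1 : 10 ^ 3 * lnM * (q:ℝ) ^ 4 ≤ α := by
    rw [hα, le_div_iff₀ hε]
    nlinarith [show 0 < 10 ^ 3 * lnM * (q:ℝ) ^ 4 by positivity]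
  have hα2 : 1 ≤ α := by nlinarith
  have hα3 : 28 * (q:ℝ) ^ 4 * lnM ≤ α := by nlinarith
  have hrq : r ^ q * p ^ (q ^ 2) = (28 * (q:ℝ) ^ 4 * lnM) ^ q := by
    rw [hr, div_pow, sq, pow_mul]; field_simp
  have h1 : (28 * (q:ℝ) ^ 4 * lnM) ^ q * α ≤ α ^ (q ^ 2) := by
    calc _ ≤ α ^ q * α := by gcongr
      _ = α ^ (q + 1) := by rw [pow_succ]
      _ ≤ _ := pow_le_pow_right₀ hα2 (by nlinarith)
  have hrα : r ^ q * α ≤ x := by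
    have hpp : 0 < p ^ (q ^ 2) := by positivity
    rw [← hrq, ← hpx] at h1
    refine le_of_mul_le_mul_left ?_ hpp
    linarith
  have h2 : ε * α = 10 ^ 3 * lnM * (q:ℝ) ^ 4 := by rw [hα]; field_simp
  have hr0 : 0 < r := by rw [hr]; positivity
  have h3 : lnM * (ε * (r ^ q * α)) ≤ lnM * (ε * x) := by gcongr
  have h4 : lnM * (ε * (r ^ q * α)) = r ^ q * (lnM * (10 ^ 3 * lnM * (q:ℝ) ^ 4)) := by
    rw [← h2]; ring
  rw [h4] at h3
  have h5 : (4.8:ℝ) ≤ lnM * (10 ^ 3 * lnM * (q:ℝ) ^ 4) := by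
    have : (0.69:ℝ) * (10 ^ 3 * 0.69 * 81) ≤ lnM * (10 ^ 3 * lnM * (q:ℝ) ^ 4) := by gcongr
    norm_num at this ⊢
    linarith
  have := mul_le_mul_of_nonneg_left h5 (pow_pos hr0 q).le
  linarith

set_option maxHeartbeats 1000000 in
/-- main 2-sided conversion. If the `ε`-nontrivial pair `(L',L)`
over `Ξ^n` admits a combinatorial non-adaptive 2-sided partial
`(ε/2, 1/(4q³), q, q⁹ log₂|Ξ| (log₂(log₂|Ξ|/ε))² n)`-test, then it admits a
`p`-sampling 2-sided `(ε, 1/10)`-test with `p = α n^{-1/q²}`,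
`α = 10³ ln|Ξ| q⁴/ε`: a (sample-based, non-adaptive) acceptance rule `A`,
depending on the sampled set `U` and only on the restriction `w_U` of the input,
that accepts every `w ∈ L'` with probability at least `9/10` and accepts every
word `ε`-far from `L` with probability at most `1/10`. -/
theorem stmt1 {n q : ℕ} {Ξ : Type*} [Fintype Ξ] (ε : ℝ)
    (hΞ : 2 ≤ Fintype.card Ξ) (hq : 3 ≤ q) (hε : 0 < ε) (hε1 : ε ≤ 1)
    (hn : ((24 * (q:ℝ)^10 * (Real.logb 2 (Fintype.card Ξ))^2 / ε) ^ q) < (n:ℝ))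
    (L' L : Set (Fin n → Ξ)) (hLL : L' ⊆ L) (hnt : NontrivialPair ε L' L)
    (P : ProbFormula n Ξ) (hcomb : P.Combinatorial)
    (htest : P.IsPartialTest (ε/2) (1/(4*(q:ℝ)^3)) L' L)
    (hqf : P.IsQForm q)
    (hsupp : ((P.supp.card : ℝ)) ≤ (q:ℝ)^9 * Real.logb 2 (Fintype.card Ξ)
        * (Real.logb 2 (Real.logb 2 (Fintype.card Ξ) / ε))^2 * n) :
    ∃ A : Finset (Fin n) → (Fin n → Ξ) → Bool,
      (∀ U : Finset (Fin n), ∀ w w' : Fin n → Ξ,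
        (∀ i ∈ U, w i = w' i) → A U w = A U w') ∧
      (∀ w ∈ L', 1 - 1/10 ≤ sampleProb n
          ((10^3 * Real.log (Fintype.card Ξ) * (q:ℝ)^4 / ε) * (n:ℝ) ^ (-(1:ℝ)/(q:ℝ)^2))
          (fun U => A U w = true)) ∧
      (∀ w : Fin n → Ξ, FarFrom ε w L → sampleProb n
          ((10^3 * Real.log (Fintype.card Ξ) * (q:ℝ)^4 / ε) * (n:ℝ) ^ (-(1:ℝ)/(q:ℝ)^2))
          (fun U => A U w = true) ≤ 1/10) := by
  have hM1 : (2:ℝ) ≤ Fintype.card Ξ := by exact_mod_cast hΞ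
  have hlog : 0.69 ≤ Real.log (Fintype.card Ξ) := by
    have h1 := Real.log_le_log (by norm_num) hM1
    have h2 := Real.log_two_gt_d9
    linarith
  have hl0 : 0 < Real.log (Fintype.card Ξ) := by linarith
  have hq0 : (3:ℝ) ≤ q := by exact_mod_cast hq
  have hn0 : (0:ℝ) < n := by
    refine lt_of_le_of_lt ?_ hn
    positivity
  set α : ℝ := 10^3 * Real.log (Fintype.card Ξ) * (q:ℝ)^4 / ε with hα
  set p : ℝ := α * (n:ℝ) ^ (-(1:ℝ)/(q:ℝ)^2) with hp
  have hα0 : 0 < α := by positivity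
  have hp0 : 0 < p := by positivity
  have hpx : p ^ (q ^ 2) * n = α ^ (q ^ 2) := by
    rw [hp, mul_pow, ← Real.rpow_mul_natCast hn0.le]
    have : (-(1:ℝ)/(q:ℝ)^2) * ((q ^ 2 : ℕ) : ℝ) = -1 := by push_cast; field_simp
    rw [this, Real.rpow_neg_one]
    field_simp
  clear_value p
  rcases le_or_gt 1 p with hp1 | hp1
  · -- degenerate case: the full set has weight at least one
    refine ⟨fun U w => decide (U = Finset.univ ∧ w ∈ L'), ?_, ?_, ?_⟩
    · intro U w w' h
      by_cases hU : U = Finset.univ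
      · subst hU
        have : w = w' := funext fun i => h i (Finset.mem_univ _)
        rw [this]
      · simp [hU]
    · intro w hw
      have : sampleProb n p (fun U => decide (U = Finset.univ ∧ w ∈ L') = true) = p ^ n := by
        unfold sampleProb
        have : (Finset.univ.filter fun U : Finset (Fin n) =>
          decide (U = Finset.univ ∧ w ∈ L') = true) = {Finset.univ} := by
          ext U; simp [hw]
        convert Finset.sum_singleton (fun R : Finset (Fin n) =>
          p ^ R.card * (1 - p) ^ (n - R.card)) Finset.univ using 2
        · convert this
        · simp
      rw [this]
      have : 1 ≤ p ^ n := one_le_pow₀ hp1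
      linarith
    · intro w hw
      have hwL : w ∉ L' := by
        intro h
        have := hw w (hLL h)
        unfold FarWord at this
        simp at this
        nlinarith
      unfold sampleProb
      simp [hwL]
  · set V := P.supp with hVdef
    set m : ℝ := (V.card : ℝ) with hm
    have hm0 : 0 < m := by rw [hm]; exact_mod_cast supp_pos P
    have hV : ∀ Q ∈ V, Q.card = q := fun Q hQ => hqf Q (Finset.mem_filter.1 hQ).2
    set r : ℝ := 28 * (q:ℝ) ^ 4 * Real.log (Fintype.card Ξ) / p ^ q with hr
    have hq4 : (81:ℝ) ≤ (q:ℝ) ^ 4 := by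
      calc (81:ℝ) = 3 ^ 4 := by norm_num
        _ ≤ _ := by gcongr
    have hpq : 0 < p ^ q := by positivity
    have hr1 : 1 ≤ r := by
      rw [hr, le_div_iff₀ hpq]
      have : p ^ q ≤ 1 := pow_le_one₀ hp0.le hp1.le
      nlinarith
    have hrq := numerics2 hq hε hε1 hlog hn0 hp0 hα hpx hr
    set D0 : ℝ := 2 * q * m / (ε * n) with hD0def
    have hD0 : 0 < D0 := by positivity
    obtain ⟨k, hk, j, hj1, hjq, F, hFV, hFcard, hFj, hFdeg⟩ :=
      exists_family (by omega) V hV D0 r hD0 hr1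
    set C := hiSet V (D0 * r ^ (k+1)) with hC
    have hCard0 : ((hiSet V D0).card : ℝ) ≤ ε / 2 * n := by
      have h := hiSet_card V hV D0
      have e : ε / 2 * n * D0 = q * m := by rw [hD0def]; field_simp
      rw [← hm, ← e] at h
      exact le_of_mul_le_mul_right h hD0
    have hrk : 1 ≤ r ^ (k+1) := one_le_pow₀ hr1
    have hCsub : C ⊆ hiSet V D0 := hiSet_anti V (by nlinarith)
    have hCcard : (C.card : ℝ) ≤ ε / 2 * n := by
      refine le_trans ?_ hCard0
      exact_mod_cast Finset.card_le_card hCsub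
    have hcont := contained_card hnt P hcomb htest (hiSet V D0) hCard0
    rw [← hVdef, ← hm] at hcont
    have hq3 : (27:ℝ) ≤ (q:ℝ) ^ 3 := by
      calc (27:ℝ) = 3 ^ 3 := by norm_num
        _ ≤ _ := by gcongr
    have hN : 53 / 54 * m ≤ (q:ℝ) ^ 2 * F.card := by
      have h1 : ((V.filter fun Q => ¬ Q ⊆ hiSet V D0).card : ℝ) ≤ (q:ℝ) ^ 2 * F.card := by
        exact_mod_cast hFcard
      have h2 : ((V.filter fun Q => Q ⊆ hiSet V D0).card : ℝ) +
          (V.filter fun Q => ¬ Q ⊆ hiSet V D0).card = m := by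
        rw [hm]
        exact_mod_cast Finset.card_filter_add_card_filter_not (s := V)
          (fun Q => Q ⊆ hiSet V D0)
      have h3 : 1 / (4 * (q:ℝ) ^ 3) ≤ 1 / 108 :=
        one_div_le_one_div_of_le (by norm_num) (by linarith)
      have h4 := mul_le_mul_of_nonneg_right h3 hm0.le
      linarith
    -- at most `m/(4q³)` exceptions is at most a tenth of `F`
    have hδ : 1 / (4 * (q:ℝ) ^ 3) * m ≤ 0.1 * F.card := by
      rw [div_mul_eq_mul_div, div_le_iff₀ (by positivity)]
      have : (q:ℝ) * (53 / 54 * m) ≤ q * ((q:ℝ) ^ 2 * F.card) := by gcongr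
      have h3m : 3 * m ≤ q * m := mul_le_mul_of_nonneg_right hq0 hm0.le
      have e : (q:ℝ) * ((q:ℝ) ^ 2 * F.card) = (q:ℝ) ^ 3 * F.card := by ring
      rw [e] at this
      linarith
    have hDk1 : 1 ≤ D0 * r ^ k := by
      have hFpos : 0 < (F.card : ℝ) := by
        by_contra h
        have : (F.card : ℝ) = 0 := le_antisymm (not_lt.1 h) (by positivity)
        rw [this] at hN
        linarith
      obtain ⟨Q, hQ⟩ := Finset.card_pos.1 (by exact_mod_cast hFpos : 0 < F.card)
      have hQC : 0 < (Q \ C).card := by rw [hFj Q hQ]; omega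
      obtain ⟨i, hi⟩ := Finset.card_pos.1 hQC
      rw [Finset.mem_sdiff] at hi
      have h1 := hFdeg Q hQ i hi.1 hi.2
      have h2 : 0 < fdeg V i := Finset.card_pos.2 ⟨Q, Finset.mem_filter.2 ⟨hFV hQ, hi.1⟩⟩
      have h3 : (1:ℝ) ≤ fdeg V i := by exact_mod_cast h2
      linarith
    obtain ⟨col, hcol⟩ := exists_family_col V F hFV hV C (D0 * r ^ k) (by linarith) hFdeg
    refine final_lemma hp0 hp1.le hΞ C F j _ (Nat.succ_pos _) hFj col hcol P.S P.S_local
      (fun w => w ∈ L') (fun w => FarFrom ε w L) ?_ ?_ ?_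
    · intro w hw
      have h1 := htest.1 w hw
      have c1 := sat_count P hcomb w
      rw [← hVdef, ← hm] at c1
      have c3 : ((V.filter fun Q => P.S Q w = 1).card : ℝ) +
          (V.filter fun Q => ¬ P.S Q w = 1).card = m := by
        rw [hm]
        exact_mod_cast Finset.card_filter_add_card_filter_not (s := V) (fun Q => P.S Q w = 1)
      have c4 : ((F.filter fun Q => P.S Q w = 1).card : ℝ) +
          (F.filter fun Q => ¬ P.S Q w = 1).card = F.card := by
        exact_mod_cast Finset.card_filter_add_card_filter_not (s := F) (fun Q => P.S Q w = 1)
      have c5 : ((F.filter fun Q => ¬ P.S Q w = 1).card : ℝ) ≤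
          (V.filter fun Q => ¬ P.S Q w = 1).card := by
        exact_mod_cast Finset.card_le_card (Finset.filter_subset_filter _ hFV)
      have c6 := mul_le_mul_of_nonneg_left h1 hm0.le
      linarith
    · intro w hw u hu
      have h1 := htest.2 u (far_modify hw C hCcard hu)
      have c1 := sat_count P hcomb u
      rw [← hVdef, ← hm] at c1
      have c5 : ((F.filter fun Q => P.S Q u = 1).card : ℝ) ≤
          (V.filter fun Q => P.S Q u = 1).card := by
        exact_mod_cast Finset.card_le_card (Finset.filter_subset_filter _ hFV)
      have c6 := mul_le_mul_of_nonneg_left h1 hm0.le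
      linarith
    · refine numerics (r := r) (D := D0 * r ^ k) (m := m) hq hjq hp0 hp1.le (by linarith) hl0
        (by linarith) hm0 (by positivity) ?_ hN ?_ ?_ ?_
      · rw [hr]; field_simp
      · have := Nat.floor_le (show 0 ≤ q * (D0 * r ^ k) by positivity)
        have h1 : 1 * 1 ≤ (q:ℝ) * (D0 * r ^ k) :=
          mul_le_mul (by linarith) hDk1 (by norm_num) (by linarith)
        push_cast
        linarith
      · have := hiSet_card V hV (D0 * r ^ (k+1))
        rw [← hC, ← hm] at this
        rw [mul_assoc, ← pow_succ]
        exact this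
      · rw [mul_assoc, ← pow_succ]
        have h1 : r ^ (k+1) ≤ r ^ q := pow_le_pow_right₀ hr1 hk
        have h2 : 2.4 * (D0 * r ^ (k+1)) ≤ D0 * (2.4 * r ^ q) := by
          have := mul_le_mul_of_nonneg_left h1 hD0.le
          linarith
        have h3 : D0 * (2.4 * r ^ q) ≤ D0 * (Real.log (Fintype.card Ξ) * (ε * n) / 2) := by
          apply mul_le_mul_of_nonneg_left _ hD0.le
          linarith
        have h4 : D0 * (Real.log (Fintype.card Ξ) * (ε * n) / 2)
            = q * Real.log (Fintype.card Ξ) * m := by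
          rw [hD0def]; field_simp
        linarith
end
end

section
/- Let Ξ be a finite alphabet with |Ξ| ≥ 2, 0 < ε ≤ 1, 0 < δ < 1/16, and let (L',L) over Ξ^n be ε-nontrivial and admit a non-adaptive 2-sided partial (ε/2, δ, q)-test. Then (L',L) admits a combinatorial non-adaptive 2-sided partial (ε/2, δ', q, αn)-test, where α = δ^{−2} log₂(|Ξ|) and δ' = 16δ·log₂(16q·δ^{−2} log₂(|Ξ|)/ε). -/
open scoped Classical BigOperators

noncomputable section

lemma aux_greedy {ι W : Type*} [Fintype ι] [Fintype W] (μ : ι → ℝ) (h0 : ∀ Q, 0 ≤ μ Q)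
    (h1 : ∑ Q, μ Q = 1) (b : W → ι → ℕ) (hb : ∀ w Q, b w Q ≤ 1) (p : ℝ) (hp : 0 ≤ p)
    (hbp : ∀ w, ∑ Q, μ Q * (b w Q : ℝ) ≤ p) (t : ℕ) :
    ∃ c : ι → ℕ, (∀ Q, c Q ≠ 0 → 0 < μ Q) ∧ ∑ Q, c Q = t ∧
      ∑ w, (2:ℝ) ^ (∑ Q, c Q * b w Q) ≤ Fintype.card W * (1 + p) ^ t := by
  induction t with
  | zero => exact ⟨fun _ => 0, by simp, by simp, by simp⟩
  | succ t ih =>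
    obtain ⟨c, hc, hct, hcs⟩ := ih
    set φ : W → ℝ := fun w => (2:ℝ) ^ (∑ Q, c Q * b w Q) with hφ
    have key : ∑ Q, μ Q * (∑ w, φ w * (1 + b w Q)) ≤ ∑ Q, μ Q * (Fintype.card W * (1 + p) ^ (t+1)) := by
      rw [← Finset.sum_mul, h1, one_mul]
      have e : ∑ Q, μ Q * (∑ w, φ w * (1 + b w Q)) = ∑ w, φ w * (1 + ∑ Q, μ Q * (b w Q : ℝ)) := by
        simp_rw [Finset.mul_sum]
        rw [Finset.sum_comm]
        refine Finset.sum_congr rfl fun w _ => ?_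
        rw [← h1, ← Finset.sum_add_distrib, Finset.mul_sum]
        rw [h1]
        refine Finset.sum_congr rfl fun Q _ => ?_
        ring
      rw [e]
      calc ∑ w, φ w * (1 + ∑ Q, μ Q * (b w Q : ℝ)) ≤ ∑ w, φ w * (1 + p) := by
            refine Finset.sum_le_sum fun w _ => ?_
            have := hbp w
            have : 0 ≤ φ w := by positivity
            gcongr
        _ = (∑ w, φ w) * (1 + p) := by rw [Finset.sum_mul]
        _ ≤ (Fintype.card W * (1 + p) ^ t) * (1 + p) := by gcongr
        _ = _ := by ring
    have : ∃ Q, 0 < μ Q ∧ ∑ w, φ w * (1 + b w Q) ≤ Fintype.card W * (1 + p) ^ (t+1) := by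
      by_contra! hcon
      have hex : ∃ Q, 0 < μ Q := by
        by_contra! h
        have : ∑ Q, μ Q ≤ 0 := Finset.sum_nonpos fun Q _ => h Q
        linarith
      obtain ⟨Q0, hQ0⟩ := hex
      refine absurd key (not_le.2 ?_)
      refine Finset.sum_lt_sum (fun Q _ => ?_) ⟨Q0, Finset.mem_univ _, ?_⟩
      · rcases (h0 Q).eq_or_lt with h | h
        · simp [← h]
        · exact mul_le_mul_of_nonneg_left (hcon Q h).le h.le
      · exact mul_lt_mul_of_pos_left (hcon Q0 hQ0) hQ0
    obtain ⟨Q, hQ, hs⟩ := this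
    refine ⟨fun R => c R + if R = Q then 1 else 0, ?_, ?_, ?_⟩
    · intro R hR
      by_cases h : R = Q
      · rwa [h]
      · apply hc; simpa [h] using hR
    · rw [Finset.sum_add_distrib, hct]; simp
    · refine le_trans (le_of_eq ?_) hs
      refine Finset.sum_congr rfl fun w _ => ?_
      simp only [add_mul, Finset.sum_add_distrib, pow_add, ite_mul, one_mul, zero_mul,
        Finset.sum_ite_eq', Finset.mem_univ, if_true, hφ]
      congr 1
      have := hb w Q
      interval_cases b w Q <;> norm_num

/-- bad indicator -/
def badInd {n : ℕ} {Ξ : Type*} (P : ProbFormula n Ξ) (ε : ℝ) (L' L : Set (Fin n → Ξ))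
    (w : Fin n → Ξ) (Q : Finset (Fin n)) : ℕ :=
  if w ∈ L' then (if 1/2 ≤ P.S Q w then 0 else 1)
  else if FarFrom ε w L then (if 1/2 ≤ P.S Q w then 1 else 0) else 0

lemma badInd_le {n : ℕ} {Ξ : Type*} (P : ProbFormula n Ξ) (ε : ℝ) (L' L : Set (Fin n → Ξ))
    (w : Fin n → Ξ) (Q : Finset (Fin n)) : badInd P ε L' L w Q ≤ 1 := by
  unfold badInd; split_ifs <;> simp

lemma badInd_sum {n : ℕ} {Ξ : Type*} (P : ProbFormula n Ξ) (ε δ : ℝ) (hδ : 0 ≤ δ)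
    (L' L : Set (Fin n → Ξ))
    (h : P.IsPartialTest ε δ L' L) (w : Fin n → Ξ) :
    ∑ Q, P.μ Q * (badInd P ε L' L w Q : ℝ) ≤ 2 * δ := by
  by_cases hw : w ∈ L'
  · have h1 := h.1 w hw
    have : ∑ Q, P.μ Q * (badInd P ε L' L w Q : ℝ) ≤ ∑ Q, 2 * (P.μ Q - P.μ Q * P.S Q w) := by
      refine Finset.sum_le_sum fun Q _ => ?_
      have hr := P.S_range Q w
      have hm := P.μ_nonneg Q
      simp only [badInd, hw, if_true]
      split_ifs with hs
      · push_cast; nlinarith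
      · push_cast; nlinarith
    rw [← Finset.mul_sum, Finset.sum_sub_distrib, P.μ_sum] at this
    unfold ProbFormula.sat at h1
    linarith
  · by_cases hf : FarFrom ε w L
    · have h1 := h.2 w hf
      have : ∑ Q, P.μ Q * (badInd P ε L' L w Q : ℝ) ≤ ∑ Q, 2 * (P.μ Q * P.S Q w) := by
        refine Finset.sum_le_sum fun Q _ => ?_
        have hr := P.S_range Q w
        have hm := P.μ_nonneg Q
        simp only [badInd, hw, if_false, hf, if_true]
        split_ifs with hs
        · push_cast; nlinarith
        · push_cast; nlinarith
      rw [← Finset.mul_sum] at this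
      unfold ProbFormula.sat at h1
      linarith
    · simp [badInd, hw, hf]; linarith

/-- uniform rounded formula on T -/
def uniForm {n : ℕ} {Ξ : Type*} (P : ProbFormula n Ξ) (T : Finset (Finset (Fin n)))
    (hT : T.Nonempty) : ProbFormula n Ξ where
  S := fun Q w => if 1/2 ≤ P.S Q w then 1 else 0
  μ := fun Q => if Q ∈ T then (T.card : ℝ)⁻¹ else 0
  μ_nonneg := fun Q => by split_ifs <;> positivity
  μ_sum := by
    have : (T.card : ℝ) ≠ 0 := by simpa using hT.ne_empty
    simp [this]
  S_range := fun Q w => by split_ifs <;> norm_num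
  S_local := fun Q w w' h => by rw [P.S_local Q w w' h]

lemma uniForm_pos {n : ℕ} {Ξ : Type*} (P : ProbFormula n Ξ) (T : Finset (Finset (Fin n)))
    (hT : T.Nonempty) (Q : Finset (Fin n)) : 0 < (uniForm P T hT).μ Q ↔ Q ∈ T := by
  have : (0:ℝ) < T.card := by exact_mod_cast hT.card_pos
  simp only [uniForm]
  split_ifs with h
  · simp [h, this]
  · simp [h]

lemma uniForm_comb {n : ℕ} {Ξ : Type*} (P : ProbFormula n Ξ) (T : Finset (Finset (Fin n)))
    (hT : T.Nonempty) : (uniForm P T hT).Combinatorial := by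
  refine ⟨fun Q _ w => ?_, fun Q Q' h h' => ?_⟩
  · simp only [uniForm]; split_ifs <;> simp
  · rw [uniForm_pos] at h h'
    simp [uniForm, h, h']

lemma uniForm_supp {n : ℕ} {Ξ : Type*} (P : ProbFormula n Ξ) (T : Finset (Finset (Fin n)))
    (hT : T.Nonempty) : (uniForm P T hT).supp = T := by
  ext Q; simp [ProbFormula.supp, uniForm_pos]

lemma uniForm_sat {n : ℕ} {Ξ : Type*} (P : ProbFormula n Ξ) (T : Finset (Finset (Fin n)))
    (hT : T.Nonempty) (w : Fin n → Ξ) : (uniForm P T hT).sat w =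
      (∑ Q ∈ T, if 1/2 ≤ P.S Q w then (1:ℝ) else 0) / T.card := by
  simp only [ProbFormula.sat, uniForm, ite_mul, zero_mul]
  rw [← Finset.sum_filter]
  simp only [Finset.filter_mem_eq_inter, Finset.univ_inter]
  rw [← Finset.mul_sum]; field_simp

lemma uniForm_test {n : ℕ} {Ξ : Type*} (P : ProbFormula n Ξ) (T : Finset (Finset (Fin n)))
    (hT : T.Nonempty) (ε D : ℝ) (hε : 0 ≤ ε) (L' L : Set (Fin n → Ξ)) (hLL : L' ⊆ L)
    (h : ∀ w, ∑ Q ∈ T, (badInd P ε L' L w Q : ℝ) ≤ D * T.card) :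
    (uniForm P T hT).IsPartialTest ε D L' L := by
  have hc : (0:ℝ) < T.card := by exact_mod_cast hT.card_pos
  refine ⟨fun w hw => ?_, fun w hw => ?_⟩
  · rw [uniForm_sat, le_div_iff₀ hc]
    have h1 := h w
    have : ∑ Q ∈ T, (badInd P ε L' L w Q : ℝ) + ∑ Q ∈ T, (if 1/2 ≤ P.S Q w then (1:ℝ) else 0)
        = T.card := by
      rw [← Finset.sum_add_distrib, Finset.card_eq_sum_ones]
      push_cast
      refine Finset.sum_congr rfl fun Q _ => ?_
      simp only [badInd, hw, if_true]
      split_ifs <;> simp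
    linarith
  · have hn : w ∉ L' := by
      intro hw'
      have := hw w (hLL hw')
      simp only [FarWord, ne_eq, not_true_eq_false, Finset.filter_false, Finset.card_empty,
        Nat.cast_zero] at this
      have : 0 ≤ ε * n := by positivity
      linarith
    rw [uniForm_sat, div_le_iff₀ hc]
    refine le_trans (le_of_eq ?_) (h w)
    refine Finset.sum_congr rfl fun Q _ => ?_
    simp only [badInd, hn, hw, if_true, if_false]
    split_ifs <;> simp

lemma heavy_bound {n q : ℕ} {Ξ : Type*} (ε : ℝ) (hε : 0 < ε) (L' L : Set (Fin n → Ξ))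
    (hLL : L' ⊆ L)
    (hnt : NontrivialPair ε L' L) (P : ProbFormula n Ξ) (c : Finset (Fin n) → ℕ)
    (H : Finset (Finset (Fin n))) (hq : ∀ Q ∈ H, Q.card = q)
    (hH : (H.card : ℝ) * q ≤ ε / 2 * n) (B : ℝ)
    (hB : ∀ w, ∑ Q, (c Q : ℝ) * (badInd P (ε/2) L' L w Q : ℝ) ≤ B) :
    ∑ Q ∈ H, (c Q : ℝ) ≤ 2 * B := by
  obtain ⟨⟨v, hv⟩, w, hw⟩ := hnt
  set U := H.biUnion id with hU
  have hUc : (U.card : ℝ) ≤ ε / 2 * n := by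
    refine le_trans ?_ hH
    have : U.card ≤ H.card * q := Finset.card_biUnion_le_card_mul _ _ _ (fun Q h => (hq Q h).le)
    exact_mod_cast this
  set w' : Fin n → Ξ := fun i => if i ∈ U then v i else w i with hw'
  have hfar : FarFrom (ε/2) w' L := by
    intro x hx
    have h1 := hw x hx
    unfold FarWord at h1 ⊢
    have h2 : (Finset.univ.filter fun i => w i ≠ x i) ⊆
        (Finset.univ.filter fun i => w' i ≠ x i) ∪ U := by
      intro i hi
      simp only [Finset.mem_union, Finset.mem_filter, Finset.mem_univ, true_and] at hi ⊢
      by_cases hiU : i ∈ U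
      · exact Or.inr hiU
      · left; simpa [hw', hiU] using hi
    have h3 := (Finset.card_le_card h2).trans (Finset.card_union_le _ _)
    have h4 : ((Finset.univ.filter fun i => w i ≠ x i).card : ℝ) ≤
      (Finset.univ.filter fun i => w' i ≠ x i).card + U.card := by exact_mod_cast h3
    linarith
  have hnot : w' ∉ L' := by
    intro h
    have := hfar w' (hLL h)
    simp only [FarWord, ne_eq, not_true_eq_false, Finset.filter_false, Finset.card_empty,
        Nat.cast_zero] at this
    have : 0 ≤ ε / 2 * n := by positivity
    linarith
  calc ∑ Q ∈ H, (c Q : ℝ) = ∑ Q ∈ H, ((c Q : ℝ) * (badInd P (ε/2) L' L v Q : ℝ) +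
        (c Q : ℝ) * (badInd P (ε/2) L' L w' Q : ℝ)) := by
        refine Finset.sum_congr rfl fun Q hQ => ?_
        have : P.S Q w' = P.S Q v := by
          apply P.S_local
          intro i hi
          have : i ∈ U := Finset.mem_biUnion.2 ⟨Q, hQ, hi⟩
          simp [hw', this]
        simp only [badInd, hv, hnot, hfar, if_true, if_false, this]
        split_ifs <;> simp
    _ ≤ ∑ Q, ((c Q : ℝ) * (badInd P (ε/2) L' L v Q : ℝ) +
        (c Q : ℝ) * (badInd P (ε/2) L' L w' Q : ℝ)) :=
        Finset.sum_le_sum_of_subset_of_nonneg (Finset.subset_univ _) (fun _ _ _ => by positivity)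
    _ ≤ 2 * B := by
        rw [Finset.sum_add_distrib]; linarith [hB v, hB w']

lemma bucket {ι : Type*} [Fintype ι] (c : ι → ℕ) (t : ℕ) (ht : 0 < t) (hct : ∑ Q, c Q = t)
    (M : ℝ) (hM : 1 ≤ M)
    (hheavy : 2 * ∑ Q ∈ Finset.univ.filter (fun Q => M < (c Q : ℝ)), (c Q : ℝ) ≤ t) :
    ∃ j : ℕ, ∃ T : Finset ι, T.Nonempty ∧ (∀ Q ∈ T, 2 ^ j ≤ c Q) ∧
      (t : ℝ) ≤ 4 * Real.logb 2 (2 * M) * 2 ^ j * T.card := by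
  set J := Nat.log 2 ⌊M⌋₊ + 1 with hJ
  set T : ℕ → Finset ι := fun j => Finset.univ.filter fun Q =>
    c Q ≠ 0 ∧ (c Q : ℝ) ≤ M ∧ Nat.log 2 (c Q) = j with hT
  have hfl : ⌊M⌋₊ ≠ 0 := by
    have : 1 ≤ ⌊M⌋₊ := Nat.le_floor (by exact_mod_cast hM)
    omega
  have hJl : (J : ℝ) ≤ Real.logb 2 (2 * M) := by
    rw [Real.le_logb_iff_rpow_le (by norm_num) (by linarith), Real.rpow_natCast, hJ, pow_succ]
    have h1 : 2 ^ Nat.log 2 ⌊M⌋₊ ≤ ⌊M⌋₊ := Nat.pow_log_le_self 2 hfl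
    have h2 : (⌊M⌋₊ : ℝ) ≤ M := Nat.floor_le (by linarith)
    have h3 : (2:ℝ) ^ Nat.log 2 ⌊M⌋₊ ≤ ⌊M⌋₊ := by exact_mod_cast h1
    linarith
  have hsum : ∑ Q ∈ Finset.univ.filter (fun Q => c Q ≠ 0 ∧ (c Q:ℝ) ≤ M), (c Q : ℝ) =
      ∑ j ∈ Finset.range J, ∑ Q ∈ T j, (c Q : ℝ) := by
    rw [← Finset.sum_fiberwise_of_maps_to (t := Finset.range J) (g := fun Q => Nat.log 2 (c Q))]
    · refine Finset.sum_congr rfl fun j _ => ?_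
      simp only [hT, Finset.filter_filter, and_assoc]
    · intro Q hQ
      simp only [Finset.mem_filter, Finset.mem_univ, true_and] at hQ
      rw [Finset.mem_range, hJ, Nat.lt_succ_iff]
      exact Nat.log_mono_right (Nat.le_floor hQ.2)
  have hlight : (t:ℝ) ≤ 2 * ∑ Q ∈ Finset.univ.filter (fun Q => c Q ≠ 0 ∧ (c Q:ℝ) ≤ M), (c Q : ℝ) := by
    have h1 : ∑ Q ∈ Finset.univ.filter (fun Q => c Q ≠ 0 ∧ (c Q:ℝ) ≤ M), (c Q : ℝ) +
      ∑ Q ∈ Finset.univ.filter (fun Q => M < (c Q : ℝ)), (c Q : ℝ) = t := by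
      rw [← hct, Finset.sum_filter, Finset.sum_filter, ← Finset.sum_add_distrib]
      push_cast
      refine Finset.sum_congr rfl fun Q _ => ?_
      by_cases h : M < (c Q : ℝ)
      · simp [h, not_le.2 h]
      · by_cases h' : c Q = 0
        · simp [h']
        · simp [h, h', not_lt.1 h]
    linarith
  have hpig : ∃ j ∈ Finset.range J, (t:ℝ) / (2 * J) ≤ ∑ Q ∈ T j, (c Q : ℝ) := by
    apply Finset.exists_le_of_sum_le (by simp [hJ])
    rw [← hsum]
    have : (0:ℝ) < J := by rw [hJ]; positivity
    simp only [Finset.sum_const, Finset.card_range, nsmul_eq_mul]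
    rw [show (J:ℝ) * (t / (2 * J)) = t / 2 by field_simp]
    linarith
  obtain ⟨j, _, hj⟩ := hpig
  have hJ0 : (0:ℝ) < J := by rw [hJ]; positivity
  have ht0 : (0:ℝ) < t := by exact_mod_cast ht
  have hup : ∑ Q ∈ T j, (c Q : ℝ) ≤ (T j).card * 2 ^ (j+1) := by
    rw [← nsmul_eq_mul]
    apply Finset.sum_le_card_nsmul
    intro Q hQ
    simp only [hT, Finset.mem_filter, Finset.mem_univ, true_and] at hQ
    have : c Q < 2 ^ (j+1) := by rw [← hQ.2.2]; exact Nat.lt_pow_succ_log_self (by norm_num) _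
    exact_mod_cast this.le
  refine ⟨j, T j, ?_, ?_, ?_⟩
  · rw [Finset.nonempty_iff_ne_empty]
    intro h
    rw [h] at hj
    simp only [Finset.sum_empty] at hj
    have : 0 < (t:ℝ) / (2 * J) := by positivity
    linarith
  · intro Q hQ
    simp only [hT, Finset.mem_filter, Finset.mem_univ, true_and] at hQ
    rw [← hQ.2.2]
    exact Nat.pow_log_le_self 2 hQ.1
  · have h := hj.trans hup
    rw [div_le_iff₀ (by positivity)] at h
    calc (t:ℝ) ≤ _ := h
      _ = 4 * J * 2 ^ j * (T j).card := by ring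
      _ ≤ _ := by gcongr

lemma chern (N : ℕ) (hN : 0 < N) (n t B : ℕ) (δ : ℝ) (hδ0 : 0 < δ) (hδ : δ < 1/16)
    (ht : (n:ℝ) * Real.logb 2 N ≤ δ * t)
    (h : (2:ℝ) ^ B ≤ (N ^ n : ℕ) * (1 + 2 * δ) ^ t) : (B:ℝ) ≤ 4 * δ * t := by
  have hN' : (0:ℝ) < N := by exact_mod_cast hN
  have h1 := Real.log_le_log (by positivity) h
  push_cast at h1
  rw [Real.log_mul (by positivity) (by positivity), Real.log_pow, Real.log_pow, Real.log_pow] at h1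
  have h2 : Real.log (1 + 2 * δ) ≤ 2 * δ := by
    have := Real.log_le_sub_one_of_pos (show 0 < 1 + 2 * δ by linarith)
    linarith
  have hl2 := Real.log_two_gt_d9
  have h3 : Real.log N = Real.logb 2 N * Real.log 2 := by
    rw [Real.logb]; field_simp
  rw [h3] at h1
  have h4 : (n:ℝ) * (Real.logb 2 N * Real.log 2) ≤ δ * t * Real.log 2 := by
    rw [← mul_assoc]; gcongr
  have h5 : (t:ℝ) * Real.log (1 + 2 * δ) ≤ t * (2 * δ) := by gcongr
  have h6 : (t:ℝ) * (2 * δ) ≤ t * (3 * δ * Real.log 2) := by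
    refine mul_le_mul_of_nonneg_left ?_ (Nat.cast_nonneg t)
    nlinarith
  have : (B:ℝ) * Real.log 2 ≤ (4 * δ * t) * Real.log 2 := by linarith
  exact le_of_mul_le_mul_right this (by linarith)

/-- combinatorialization lemma. For `0 < δ < 1/16`, an
`ε`-nontrivial pair `(L',L)` admitting a non-adaptive 2-sided partial
`(ε/2,δ,q)`-test admits a combinatorial partial `(ε/2,δ',q,αn)`-test, where
`α = δ⁻² log₂|Ξ|` and `δ' = 16δ log₂(16q δ⁻² log₂|Ξ|/ε)`. -/
theorem stmt17 {n q : ℕ} {Ξ : Type*} [Fintype Ξ] (ε δ : ℝ)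
    (hΞ : 2 ≤ Fintype.card Ξ) (hε : 0 < ε) (hε1 : ε ≤ 1)
    (hδ0 : 0 < δ) (hδ : δ < 1/16)
    (L' L : Set (Fin n → Ξ)) (hLL : L' ⊆ L) (hnt : NontrivialPair ε L' L)
    (P : ProbFormula n Ξ) (htest : P.IsPartialTest (ε/2) δ L' L)
    (hqf : P.IsQForm q) :
    ∃ P' : ProbFormula n Ξ,
      P'.Combinatorial ∧
      P'.IsQForm q ∧
      ((P'.supp.card : ℝ) ≤ (Real.logb 2 (Fintype.card Ξ) / δ^2) * n) ∧
      P'.IsPartialTest (ε/2)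
        (16 * δ * Real.logb 2 (16 * q * Real.logb 2 (Fintype.card Ξ) / (δ^2 * ε)))
        L' L := by
  have hexμ : ∃ Q, 0 < P.μ Q := by
    by_contra! h
    have : ∑ Q, P.μ Q ≤ 0 := Finset.sum_nonpos fun Q _ => h Q
    linarith [P.μ_sum]
  obtain ⟨⟨v, hv⟩, w, hw⟩ := id hnt
  have hn : 0 < n := by
    rcases Nat.eq_zero_or_pos n with h | h
    · subst h
      have := hw v (hLL hv)
      simp [FarWord] at this
    · exact h
  have hq : 0 < q := by
    rcases Nat.eq_zero_or_pos q with h | h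
    · exfalso
      subst h
      have hf : FarFrom (ε/2) w L := fun x hx => by
        have := hw x hx
        unfold FarWord at this ⊢
        have : 0 ≤ ε / 2 * n := by positivity
        linarith
      have h1 := htest.1 v hv
      have h2 := htest.2 w hf
      have : P.sat v = P.sat w := by
        unfold ProbFormula.sat
        refine Finset.sum_congr rfl fun Q _ => ?_
        rcases (P.μ_nonneg Q).eq_or_lt with h | h
        · simp [← h]
        · have hQ := Finset.card_eq_zero.1 (hqf Q h)
          rw [P.S_local Q v w (by simp [hQ])]
      linarith
    · exact h
  set N := Fintype.card Ξ with hN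
  set l := Real.logb 2 N with hl
  have hl1 : 1 ≤ l := by
    rw [hl, Real.le_logb_iff_rpow_le (by norm_num) (by positivity)]
    simpa using (by exact_mod_cast hΞ : (2:ℝ) ≤ N)
  set α := l / δ^2 with hα
  have hαpos : 256 ≤ α := by
    rw [hα, le_div_iff₀ (by positivity)]; nlinarith
  have hn' : (1:ℝ) ≤ n := by exact_mod_cast hn
  have hq' : (1:ℝ) ≤ q := by exact_mod_cast hq
  set t := ⌊α * n⌋₊ with ht
  have hA : 256 ≤ α * n := by nlinarith
  have ht1 : (t:ℝ) ≤ α * n := Nat.floor_le (by linarith)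
  have ht2 : α * n < t + 1 := Nat.lt_floor_add_one _
  have htpos : 0 < t := by
    have : (0:ℝ) < t := by linarith
    exact_mod_cast this
  have ht' : (0:ℝ) < t := by exact_mod_cast htpos
  obtain ⟨c, hcμ, hct, hcs⟩ := aux_greedy P.μ P.μ_nonneg P.μ_sum (badInd P (ε/2) L' L)
    (badInd_le P (ε/2) L' L) (2 * δ) (by linarith)
    (badInd_sum P (ε/2) δ hδ0.le L' L htest) t
  have hB : ∀ w, ∑ Q, (c Q : ℝ) * (badInd P (ε/2) L' L w Q : ℝ) ≤ 4 * δ * t := by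
    intro w
    have h1 : (2:ℝ) ^ (∑ Q, c Q * badInd P (ε/2) L' L w Q) ≤ (N ^ n : ℕ) * (1 + 2 * δ) ^ t := by
      refine le_trans ?_ (hcs.trans (le_of_eq ?_))
      · exact Finset.single_le_sum
          (f := fun w => (2:ℝ) ^ (∑ Q, c Q * badInd P (ε/2) L' L w Q))
          (fun _ _ => by positivity) (Finset.mem_univ w)
      · simp [hN]
    have h2 := chern N (by omega) n t _ δ hδ0 hδ ?_ h1
    · exact_mod_cast h2
    · have : (n:ℝ) * l = δ * (δ * (α * n)) := by rw [hα]; field_simp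
      rw [← hl, this]
      gcongr
      nlinarith
  set M := 2 * q * α / ε with hM
  have hMq : 2 * q * α ≤ M := by
    rw [hM, le_div_iff₀ hε]
    have : 0 ≤ 2 * q * α := by positivity
    nlinarith
  have hM1 : 1 ≤ M := by nlinarith
  have hcq : ∀ Q, c Q ≠ 0 → Q.card = q := fun Q h => hqf Q (hcμ Q h)
  have hctR : ∑ Q, (c Q : ℝ) = t := by exact_mod_cast hct
  have hheavy : 2 * ∑ Q ∈ Finset.univ.filter (fun Q => M < (c Q : ℝ)), (c Q : ℝ) ≤ t := by
    have := heavy_bound (q := q) ε hε L' L hLL hnt P c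
      (Finset.univ.filter (fun Q => M < (c Q : ℝ))) ?_ ?_ _ hB
    · nlinarith
    · intro Q hQ
      simp only [Finset.mem_filter, Finset.mem_univ, true_and] at hQ
      apply hcq
      intro h
      rw [h] at hQ; push_cast at hQ; linarith
    · set H := Finset.univ.filter (fun Q => M < (c Q : ℝ)) with hH
      have h1 : (H.card : ℝ) * M ≤ α * n := by
        refine le_trans ?_ (hctR.le.trans ht1)
        rw [← nsmul_eq_mul]
        refine le_trans (Finset.card_nsmul_le_sum H (fun Q => (c Q : ℝ)) M ?_)
          (Finset.sum_le_sum_of_subset_of_nonneg (Finset.subset_univ _) (fun _ _ _ => by positivity))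
        intro Q hQ
        simp only [hH, Finset.mem_filter, Finset.mem_univ, true_and] at hQ
        exact hQ.le
      have h2 : (H.card : ℝ) * M = (H.card * q) * (2 / ε) * α := by rw [hM]; ring
      have h3 : (H.card * q : ℝ) * (2 / ε) ≤ n := by
        have : (H.card * q : ℝ) * (2 / ε) * α ≤ n * α := by linarith
        exact le_of_mul_le_mul_right this (by linarith)
      have h4 : (H.card * q : ℝ) = ε / 2 * ((H.card * q : ℝ) * (2 / ε)) := by field_simp
      rw [h4]
      gcongr
  obtain ⟨j, T, hT, hTj, hTt⟩ := bucket c t htpos hct M hM1 hheavy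
  have hTc : ∀ Q ∈ T, c Q ≠ 0 := fun Q hQ => by
    have := hTj Q hQ
    have : 0 < 2 ^ j := by positivity
    omega
  refine ⟨uniForm P T hT, uniForm_comb P T hT, ?_, ?_, ?_⟩
  · intro Q hQ
    rw [uniForm_pos] at hQ
    exact hcq Q (hTc Q hQ)
  · rw [uniForm_supp]
    refine le_trans ?_ ht1
    have : T.card ≤ t := by
      rw [← hct, Finset.card_eq_sum_ones]
      refine (Finset.sum_le_sum (fun Q hQ => Nat.one_le_iff_ne_zero.2 (hTc Q hQ))).trans
        (Finset.sum_le_sum_of_subset (Finset.subset_univ _))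
    exact_mod_cast this
  · apply uniForm_test P T hT _ _ (by linarith) L' L hLL
    intro w
    have hlog : Real.logb 2 (2 * M) ≤ Real.logb 2 (16 * q * l / (δ^2 * ε)) := by
      apply Real.logb_le_logb_of_le (by norm_num) (by linarith)
      have e : 16 * q * l / (δ^2 * ε) = 8 * M := by rw [hM, hα]; field_simp; norm_num
      rw [e]; linarith
    have h1 : (2:ℝ) ^ j * ∑ Q ∈ T, (badInd P (ε/2) L' L w Q : ℝ) ≤ 4 * δ * t := by
      refine le_trans ?_ (hB w)
      rw [Finset.mul_sum]
      refine le_trans (Finset.sum_le_sum (fun Q hQ => ?_))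
        (Finset.sum_le_sum_of_subset_of_nonneg (Finset.subset_univ T) (fun _ _ _ => by positivity))
      have : (2:ℝ) ^ j ≤ c Q := by exact_mod_cast hTj Q hQ
      gcongr
    have h2 : (2:ℝ) ^ j * ∑ Q ∈ T, (badInd P (ε/2) L' L w Q : ℝ) ≤
        2 ^ j * (16 * δ * Real.logb 2 (16 * q * l / (δ^2 * ε)) * T.card) := by
      calc _ ≤ 4 * δ * t := h1
        _ ≤ 4 * δ * (4 * Real.logb 2 (2 * M) * 2 ^ j * T.card) := by gcongr
        _ ≤ 4 * δ * (4 * Real.logb 2 (16 * q * l / (δ^2 * ε)) * 2 ^ j * T.card) := by gcongr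
        _ = _ := by ring
    exact le_of_mul_le_mul_left h2 (by positivity)
end
end
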